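/- arXiv:1907.11802 — 3 statements merged into one kernel-verified Lean document; each statement's English description precedes it below -/
import Mathlib

section
/- Let (W,S) be a finite Coxeter system, let R be the family of R-polynomials and R̃ the family of R̃-polynomials. Let u < w in Bruhat order, set ℓ = ℓ(u,w), and let a = a(u,w) be the least k for which there is a chain u = v₀ → v₁ → ⋯ → v_k = w of Bruhat edges. Then, writing γ_j for the coefficient of q^j in R̃_{u,w}(q): γ_j > 0 if j ∈ {a, a+2, a+4, …, ℓ}, γ_j = 0 for all other j (so in particular γ_j = 0 unless j ≡ ℓ (mod 2)), γ_ℓ = 1; and R_{u,w}(q) = Σ_{i=0}^{(ℓ−a)/2} γ_{a+2i} · q^{(ℓ−a−2i)/2} · (q−1)^{a+2i}. -/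
open Polynomial

/-- A Bruhat edge `u → v`: `v = u * t` for some reflection `t`, and `ℓ(u) < ℓ(v)`. -/
def BruhatEdge {B W : Type*} [Group W] {M : CoxeterMatrix B}
    (cs : CoxeterSystem M W) (u v : W) : Prop :=
  ∃ t : W, cs.IsReflection t ∧ v = u * t ∧ cs.length u < cs.length v

/-- Bruhat order: the reflexive-transitive closure of the Bruhat edge relation. -/
def BruhatLE {B W : Type*} [Group W] {M : CoxeterMatrix B}
    (cs : CoxeterSystem M W) : W → W → Prop :=
  Relation.ReflTransGen (BruhatEdge cs)

/-- The defining properties of the family of `R`-polynomials. -/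
def IsRFamily {B W : Type*} [Group W] {M : CoxeterMatrix B}
    (cs : CoxeterSystem M W) (R : W → W → Polynomial ℤ) : Prop :=
  (∀ u w, ¬ BruhatLE cs u w → R u w = 0) ∧
  (∀ w, R w w = 1) ∧
  (∀ u w, ∀ i : B, cs.length (w * cs.simple i) < cs.length w →
    (cs.length (u * cs.simple i) < cs.length u →
      R u w = R (u * cs.simple i) (w * cs.simple i)) ∧
    (cs.length u < cs.length (u * cs.simple i) →
      R u w = (X - 1) * R u (w * cs.simple i)
        + X * R (u * cs.simple i) (w * cs.simple i)))

/-- The defining properties of the family of `R̃`-polynomials. -/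
def IsRTildeFamily {B W : Type*} [Group W] {M : CoxeterMatrix B}
    (cs : CoxeterSystem M W) (Rt : W → W → Polynomial ℕ) : Prop :=
  (∀ u w, ¬ BruhatLE cs u w → Rt u w = 0) ∧
  (∀ w, Rt w w = 1) ∧
  (∀ u w, ∀ i : B, cs.length (w * cs.simple i) < cs.length w →
    (cs.length (u * cs.simple i) < cs.length u →
      Rt u w = Rt (u * cs.simple i) (w * cs.simple i)) ∧
    (cs.length u < cs.length (u * cs.simple i) →
      Rt u w = X * Rt u (w * cs.simple i)
        + Rt (u * cs.simple i) (w * cs.simple i)))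

/-- Dihedral polynomials. -/
noncomputable def dPoly : ℕ → Polynomial ℤ
  | 0 => 1
  | 1 => X
  | 2 => X ^ 2
  | (n + 3) => X * dPoly (n + 2) + (X + 1) * dPoly (n + 1)

/-- The degree of a vertex `x` in the Bruhat graph on the vertex set `V`:
the total number of incident edges (incoming plus outgoing). -/
noncomputable def degIn {B W : Type*} [Group W] {M : CoxeterMatrix B}
    (cs : CoxeterSystem M W) (V : Set W) (x : W) : ℕ :=
  Nat.card {y : W // y ∈ V ∧ (BruhatEdge cs x y ∨ BruhatEdge cs y x)}

/-- The Bruhat graph on the vertex set `V` is regular: all vertices have the same degree. -/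
def IsRegularOn {B W : Type*} [Group W] {M : CoxeterMatrix B}
    (cs : CoxeterSystem M W) (V : Set W) : Prop :=
  ∀ x ∈ V, ∀ y ∈ V, degIn cs V x = degIn cs V y

namespace CoxeterSystem

variable {B W : Type*} [Group W] {M : CoxeterMatrix B} (cs : CoxeterSystem M W)

open Classical in
/-- The action of a simple reflection on pairs `(t, ε)`: conjugate `t`, and change the sign `ε`
exactly when `t` is that simple reflection. -/
noncomputable def signedConj (i : B) : Function.End (W × ZMod 2) := fun p =>
  (cs.simple i * p.1 * cs.simple i, p.2 + if p.1 = cs.simple i then 1 else 0)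

theorem simple_mul_rotation_pow (i j : B) (k : ℕ) :
    cs.simple j * (cs.simple i * cs.simple j) ^ k
      = ((cs.simple i * cs.simple j) ^ k)⁻¹ * cs.simple j := by
  induction k with
  | zero => simp
  | succ k ih =>
    rw [pow_succ, ← mul_assoc, ih, ← pow_succ, pow_succ', mul_inv_rev]
    simp [mul_assoc]

open Classical in
theorem signedConj_mul_pow (i j : B) (n : ℕ) (t : W) (e : ZMod 2) :
    ((cs.signedConj i * cs.signedConj j) ^ n) (t, e) =
      ((cs.simple i * cs.simple j) ^ n * t * ((cs.simple i * cs.simple j) ^ n)⁻¹,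
        e + ∑ k ∈ Finset.range (2 * n),
          if t = ((cs.simple i * cs.simple j) ^ k)⁻¹ * cs.simple j then 1 else 0) := by
  induction n with
  | zero => simp; rfl
  | succ n ih =>
    set r := cs.simple i * cs.simple j with hr
    have hconj (y : W) : r ^ n * t * (r ^ n)⁻¹ = y ↔ t = (r ^ n)⁻¹ * (y * r ^ n) := by
      rw [mul_inv_eq_iff_eq_mul, eq_inv_mul_iff_mul_eq]
    have h₁ : r ^ n * t * (r ^ n)⁻¹ = cs.simple j ↔ t = (r ^ (2 * n))⁻¹ * cs.simple j := by
      rw [hconj, cs.simple_mul_rotation_pow, two_mul, pow_add, mul_inv_rev, mul_assoc]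
    have h₂ : cs.simple j * (r ^ n * t * (r ^ n)⁻¹) * cs.simple j = cs.simple i ↔
        t = (r ^ (2 * n + 1))⁻¹ * cs.simple j := by
      have hswap (y : W) : cs.simple j * y * cs.simple j = cs.simple i ↔
          y = cs.simple j * r := by
        constructor
        · intro h
          rw [hr, ← h]
          simp [mul_assoc]
        · rintro rfl
          simp [hr, mul_assoc]
      rw [hswap, hconj, mul_assoc, ← pow_succ', cs.simple_mul_rotation_pow,
        show 2 * n + 1 = n + 1 + n by ring, pow_add _ (n + 1), mul_inv_rev, mul_assoc]
    rw [pow_succ', show (2 * (n + 1)) = 2 * n + 1 + 1 by ring, Finset.sum_range_succ,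
      Finset.sum_range_succ]
    change (cs.signedConj i) ((cs.signedConj j)
      (((cs.signedConj i * cs.signedConj j) ^ n) (t, e))) = _
    rw [ih]
    simp only [signedConj, h₁, h₂]
    refine Prod.ext ?_ ?_
    · simp [pow_succ', hr, mul_assoc]
    · simp only [add_assoc]

theorem isLiftable_signedConj : M.IsLiftable cs.signedConj := by
  classical
  intro i j
  funext ⟨t, e⟩
  rw [signedConj_mul_pow, cs.simple_mul_simple_pow, two_mul, Finset.sum_range_add]
  simp only [pow_add, cs.simple_mul_simple_pow, one_mul]
  rw [← two_mul, show (2 : ZMod 2) = 0 from rfl]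
  simp
  rfl

/-- The signed conjugation action of `W` on `W × ZMod 2`. -/
noncomputable def signedConjHom : W →* Function.End (W × ZMod 2) :=
  cs.lift ⟨cs.signedConj, cs.isLiftable_signedConj⟩

/-- The reflection cocycle: the parity of the number of occurrences of `t` in the right inversion
sequence of any word for `w`. -/
noncomputable def reflectionCocycle (w t : W) : ZMod 2 := (cs.signedConjHom w (t, 0)).2

open Classical in
theorem signedConjHom_wordProd (ω : List B) (t : W) (e : ZMod 2) :
    cs.signedConjHom (cs.wordProd ω) (t, e) =
      (cs.wordProd ω * t * (cs.wordProd ω)⁻¹, e + ((cs.rightInvSeq ω).count t : ZMod 2)) := by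
  induction ω with
  | nil => simp; rfl
  | cons i ω ih =>
    rw [cs.wordProd_cons, map_mul]
    change cs.signedConjHom (cs.simple i) (cs.signedConjHom (cs.wordProd ω) (t, e)) = _
    rw [ih, signedConjHom, cs.lift_apply_simple, signedConj, rightInvSeq, List.count_cons]
    refine Prod.ext (by simp [mul_assoc]) ?_
    have : cs.wordProd ω * t * (cs.wordProd ω)⁻¹ = cs.simple i ↔
        (cs.wordProd ω)⁻¹ * cs.simple i * cs.wordProd ω = t := by
      rw [mul_inv_eq_iff_eq_mul, mul_assoc, inv_mul_eq_iff_eq_mul, eq_comm]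
    simp only [this, beq_iff_eq]
    push_cast
    rw [add_assoc]

theorem signedConjHom_apply (w t : W) (e : ZMod 2) :
    cs.signedConjHom w (t, e) = (w * t * w⁻¹, e + cs.reflectionCocycle w t) := by
  obtain ⟨ω, rfl⟩ := cs.wordProd_surjective w
  simp [reflectionCocycle, signedConjHom_wordProd]

theorem reflectionCocycle_one (t : W) : cs.reflectionCocycle 1 t = 0 := by
  rw [reflectionCocycle, map_one]
  rfl

theorem reflectionCocycle_mul (v w t : W) :
    cs.reflectionCocycle (v * w) t
      = cs.reflectionCocycle w t + cs.reflectionCocycle v (w * t * w⁻¹) := by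
  have h : cs.signedConjHom (v * w) (t, 0) = cs.signedConjHom v (cs.signedConjHom w (t, 0)) := by
    rw [map_mul]; rfl
  simp only [signedConjHom_apply, zero_add] at h
  exact congrArg Prod.snd h

open Classical in
theorem reflectionCocycle_simple (i : B) (t : W) :
    cs.reflectionCocycle (cs.simple i) t = if t = cs.simple i then 1 else 0 := by
  simp [reflectionCocycle, signedConjHom, cs.lift_apply_simple, signedConj]

theorem IsReflection.reflectionCocycle_self {t : W} (ht : cs.IsReflection t) :
    cs.reflectionCocycle t t = 1 := by
  obtain ⟨v, i, rfl⟩ := ht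
  have h := cs.reflectionCocycle_mul v v⁻¹ (v * cs.simple i * v⁻¹)
  rw [mul_inv_cancel, reflectionCocycle_one] at h
  rw [reflectionCocycle_mul, reflectionCocycle_mul]
  have e₁ : v⁻¹ * (v * cs.simple i * v⁻¹) * v⁻¹⁻¹ = cs.simple i := by group
  rw [e₁] at h ⊢
  rw [reflectionCocycle_simple]
  simp only [if_true, inv_simple, simple_mul_simple_self, one_mul]
  linear_combination -h

theorem length_mul_lt_of_reflectionCocycle_ne_zero {w t : W}
    (h : cs.reflectionCocycle w t ≠ 0) : cs.length (w * t) < cs.length w := by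
  classical
  obtain ⟨ω, hω, rfl⟩ := cs.exists_isReduced w
  refine (cs.isRightInversion_of_mem_rightInvSeq hω ?_).2
  contrapose! h
  simp [reflectionCocycle, signedConjHom_wordProd, List.count_eq_zero_of_not_mem h]

theorem IsReflection.length_mul_lt_iff {t : W} (ht : cs.IsReflection t) (w : W) :
    cs.length (w * t) < cs.length w ↔ cs.reflectionCocycle w t ≠ 0 := by
  refine ⟨fun h h0 => ?_, cs.length_mul_lt_of_reflectionCocycle_ne_zero⟩
  have : cs.reflectionCocycle (w * t) t ≠ 0 := by
    rw [reflectionCocycle_mul, IsReflection.reflectionCocycle_self cs ht, mul_inv_cancel_right, h0]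
    decide
  have h' := cs.length_mul_lt_of_reflectionCocycle_ne_zero this
  rw [mul_assoc, ht.mul_self, mul_one] at h'
  omega

/-- Induction along the recursion defining the `R`-polynomials. -/
theorem rightDescent_induction {P : W → W → Prop} (one : ∀ u, P u 1)
    (down : ∀ u w i, cs.length (w * cs.simple i) < cs.length w →
      cs.length (u * cs.simple i) < cs.length u →
      P (u * cs.simple i) (w * cs.simple i) → P u w)
    (up : ∀ u w i, cs.length (w * cs.simple i) < cs.length w →
      cs.length u < cs.length (u * cs.simple i) →
      P u (w * cs.simple i) → P (u * cs.simple i) (w * cs.simple i) → P u w)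
    (u w : W) : P u w := by
  induction hn : cs.length w using Nat.strong_induction_on generalizing u w with
  | _ n ih =>
    subst hn
    by_cases hw : w = 1
    · exact hw ▸ one u
    obtain ⟨i, hi⟩ := cs.exists_rightDescent_of_ne_one hw
    have h := fun v => ih _ hi v _ rfl
    rcases (cs.length_mul_simple_ne u i).lt_or_gt with hu | hu
    · exact down u w i hi hu (h _)
    · exact up u w i hi hu (h _) (h _)

end CoxeterSystem

section Bruhat

variable {B W : Type*} [Group W] {M : CoxeterMatrix B} {cs : CoxeterSystem M W}

theorem BruhatEdge.mul_simple {u v : W} (h : BruhatEdge cs u v) (i : B) :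
    v = u * cs.simple i ∨ BruhatEdge cs (u * cs.simple i) (v * cs.simple i) := by
  obtain ⟨t, ht, rfl, hl⟩ := h
  by_cases hts : t = cs.simple i
  · exact Or.inl (by rw [hts])
  right
  have ht' : cs.IsReflection (cs.simple i * t * cs.simple i) := by
    simpa using ht.conj (cs.simple i)
  have hmul : u * cs.simple i * (cs.simple i * t * cs.simple i) = u * t * cs.simple i := by
    simp [mul_assoc]
  refine ⟨_, ht', hmul.symm, ?_⟩
  have h0 : cs.reflectionCocycle u t = 0 := by
    by_contra h
    have := (ht.length_mul_lt_iff cs u).2 h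
    omega
  have hne := ht'.length_mul_left_ne (u * cs.simple i)
  have hnlt : ¬ cs.length (u * cs.simple i * (cs.simple i * t * cs.simple i))
      < cs.length (u * cs.simple i) := by
    rw [ht'.length_mul_lt_iff cs, not_not, CoxeterSystem.reflectionCocycle_mul,
      CoxeterSystem.reflectionCocycle_simple, if_neg]
    · simp [mul_assoc, h0]
    · intro h
      apply hts
      simpa [mul_assoc] using congrArg (fun x => cs.simple i * x * cs.simple i) h
  rw [hmul] at hne hnlt
  omega

theorem bruhatEdge_mul_simple {u : W} {i : B} (h : cs.length u < cs.length (u * cs.simple i)) :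
    BruhatEdge cs u (u * cs.simple i) :=
  ⟨_, cs.isReflection_simple i, rfl, h⟩

theorem mul_simple_bruhatEdge {u : W} {i : B} (h : cs.length (u * cs.simple i) < cs.length u) :
    BruhatEdge cs (u * cs.simple i) u :=
  ⟨_, cs.isReflection_simple i, by simp, h⟩

theorem BruhatEdge.odd_length_sub {u v : W} (h : BruhatEdge cs u v) :
    ∃ d, cs.length v = cs.length u + 2 * d + 1 := by
  obtain ⟨t, ht, rfl, hl⟩ := h
  have h₁ := cs.length_mul_mod_two u t
  have h₂ := Nat.odd_iff.1 ht.odd_length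
  exact ⟨(cs.length (u * t) - cs.length u) / 2, by omega⟩

variable (cs) in
/-- `BruhatChain cs k u w`: there is a chain of `k` Bruhat edges from `u` to `w`. -/
inductive BruhatChain : ℕ → W → W → Prop
  | refl (u : W) : BruhatChain 0 u u
  | tail {k : ℕ} {u v w : W} : BruhatChain k u v → BruhatEdge cs v w → BruhatChain (k + 1) u w

namespace BruhatChain

theorem head {k : ℕ} {u v w : W} (h : BruhatEdge cs u v) (hc : BruhatChain cs k v w) :
    BruhatChain cs (k + 1) u w := by
  induction hc with
  | refl => exact (refl u).tail h
  | tail _ he ih => exact (ih h).tail he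

theorem exists_length_eq {k : ℕ} {u w : W} (h : BruhatChain cs k u w) :
    ∃ d, cs.length w = cs.length u + k + 2 * d := by
  induction h with
  | refl => exact ⟨0, rfl⟩
  | tail _ he ih =>
    obtain ⟨d, hd⟩ := ih
    obtain ⟨c, hc⟩ := he.odd_length_sub
    exact ⟨c + d, by omega⟩

theorem mul_simple_of_lt_left {k : ℕ} {u w : W} {i : B} (h : BruhatChain cs k u w)
    (hu : cs.length (u * cs.simple i) < cs.length u) :
    BruhatChain cs k (u * cs.simple i) (w * cs.simple i) := by
  induction h with
  | refl => exact refl _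
  | tail hc he ih =>
    rcases he.mul_simple i with rfl | he'
    · simpa using hc.head (mul_simple_bruhatEdge hu)
    · exact (ih hu).tail he'

theorem exists_of_succ {k : ℕ} {u w : W} (h : BruhatChain cs (k + 1) u w) :
    ∃ v, BruhatEdge cs u v ∧ BruhatChain cs k v w := by
  induction k generalizing w with
  | zero =>
    cases h with
    | tail hc he => cases hc; exact ⟨_, he, refl _⟩
  | succ k ih =>
    cases h with
    | tail hc he =>
      obtain ⟨v, hv, hvw⟩ := ih hc
      exact ⟨v, hv, hvw.tail he⟩

theorem mul_simple_of_lt_right {k : ℕ} {u w : W} {i : B} (h : BruhatChain cs k u w)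
    (hw : cs.length w < cs.length (w * cs.simple i)) :
    BruhatChain cs k (u * cs.simple i) (w * cs.simple i) := by
  induction k generalizing u with
  | zero => cases h; exact refl _
  | succ k ih =>
    obtain ⟨v, hv, hvw⟩ := h.exists_of_succ
    rcases hv.mul_simple i with rfl | hv'
    · exact hvw.tail (bruhatEdge_mul_simple hw)
    · exact (ih hvw).head hv'

theorem mul_simple_or {k : ℕ} {u w : W} (h : BruhatChain cs k u w) (i : B) :
    BruhatChain cs k (u * cs.simple i) (w * cs.simple i) ∨
      ∃ k', k = k' + 1 ∧ BruhatChain cs k' u (w * cs.simple i) := by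
  induction h with
  | refl => exact Or.inl (refl _)
  | tail hc he ih =>
    rcases he.mul_simple i with rfl | he'
    · exact Or.inr ⟨_, rfl, by simpa using hc⟩
    · rcases ih with ih | ⟨k', rfl, ih⟩
      · exact Or.inl (ih.tail he')
      · exact Or.inr ⟨_, rfl, ih.tail he'⟩

theorem of_mul_simple {k : ℕ} {u w : W} {i : B}
    (h : BruhatChain cs k (u * cs.simple i) (w * cs.simple i))
    (hw : cs.length (w * cs.simple i) < cs.length w) : BruhatChain cs k u w := by
  simpa using h.mul_simple_of_lt_right (i := i) (by simpa using hw)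

theorem iff_of_down {k : ℕ} {u w : W} {i : B}
    (hw : cs.length (w * cs.simple i) < cs.length w)
    (hu : cs.length (u * cs.simple i) < cs.length u) :
    BruhatChain cs k u w ↔ BruhatChain cs k (u * cs.simple i) (w * cs.simple i) :=
  ⟨fun h => h.mul_simple_of_lt_left hu, fun h => h.of_mul_simple hw⟩

theorem iff_of_up {k : ℕ} {u w : W} {i : B}
    (hw : cs.length (w * cs.simple i) < cs.length w) :
    BruhatChain cs k u w ↔ BruhatChain cs k (u * cs.simple i) (w * cs.simple i) ∨
      ∃ k', k = k' + 1 ∧ BruhatChain cs k' u (w * cs.simple i) := by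
  refine ⟨fun h => h.mul_simple_or i, ?_⟩
  rintro (h | ⟨k', rfl, h⟩)
  · exact h.of_mul_simple hw
  · exact h.tail (mul_simple_bruhatEdge hw)

theorem right_one {k : ℕ} {u : W} : BruhatChain cs k u 1 ↔ u = 1 ∧ k = 0 := by
  constructor
  · intro h
    obtain ⟨d, hd⟩ := h.exists_length_eq
    rw [cs.length_one] at hd
    exact ⟨cs.length_eq_zero_iff.1 (by omega), by omega⟩
  · rintro ⟨rfl, rfl⟩
    exact refl 1

theorem add_two {k : ℕ} {u w : W} (h : BruhatChain cs k u w)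
    (hlt : cs.length u + k < cs.length w) : BruhatChain cs (k + 2) u w := by
  induction u, w using cs.rightDescent_induction generalizing k with
  | one u =>
    rw [cs.length_one] at hlt
    omega
  | down u w i hw hu ih =>
    rw [iff_of_down hw hu] at h ⊢
    have := cs.length_mul_simple u i
    have := cs.length_mul_simple w i
    exact ih h (by omega)
  | up u w i hw hu ih₁ _ =>
    rcases (iff_of_up hw).1 h with h' | ⟨k', rfl, h'⟩
    · exact (h'.head (bruhatEdge_mul_simple hu)).tail (mul_simple_bruhatEdge hw)
    · have := cs.length_mul_simple w i
      exact (ih₁ h' (by omega)).tail (mul_simple_bruhatEdge hw)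

theorem add_two_mul {k : ℕ} {u w : W} (h : BruhatChain cs k u w) (n : ℕ)
    (hn : cs.length u + k + 2 * n ≤ cs.length w) : BruhatChain cs (k + 2 * n) u w := by
  induction n with
  | zero => exact h
  | succ n ih => exact (ih (by omega)).add_two (by omega)

theorem iff_exists_fun {k : ℕ} {u w : W} : BruhatChain cs k u w ↔
    ∃ f : ℕ → W, f 0 = u ∧ f k = w ∧ ∀ i < k, BruhatEdge cs (f i) (f (i + 1)) := by
  constructor
  · intro h
    induction h with
    | refl u => exact ⟨fun _ => u, rfl, rfl, by simp⟩
    | @tail k u v w _ he ih =>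
      obtain ⟨f, rfl, rfl, hf⟩ := ih
      refine ⟨fun n => if n ≤ k then f n else w, by simp, by simp, fun i hi => ?_⟩
      rcases (Nat.lt_succ_iff.1 hi).lt_or_eq with h | rfl
      · simpa [h.le, Nat.succ_le_of_lt h] using hf i h
      · simpa using he
  · rintro ⟨f, rfl, rfl, hf⟩
    induction k with
    | zero => exact refl _
    | succ k ih => exact (ih fun i hi => hf i (by omega)).tail (hf k k.lt_succ_self)

end BruhatChain

theorem BruhatLE.eq_one {u : W} (h : BruhatLE cs u 1) : u = 1 := by
  rcases Relation.ReflTransGen.cases_tail h with h | ⟨v, _, t, _, _, hl⟩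
  · exact h.symm
  · simp at hl

namespace IsRTildeFamily

variable {Rt : W → W → ℕ[X]}

theorem coeff_pos_iff (hRt : IsRTildeFamily cs Rt) (u w : W) (k : ℕ) :
    0 < (Rt u w).coeff k ↔ BruhatChain cs k u w := by
  induction u, w using cs.rightDescent_induction generalizing k with
  | one u =>
    rw [BruhatChain.right_one]
    by_cases hu : u = 1
    · subst hu
      rw [hRt.2.1, coeff_one]
      split_ifs <;> simp_all
    · rw [hRt.1 u 1 fun h => hu h.eq_one]
      simp [hu]
  | down u w i hw hu ih =>
    rw [(hRt.2.2 u w i hw).1 hu, ih, BruhatChain.iff_of_down hw hu]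
  | up u w i hw hu ih₁ ih₂ =>
    rw [(hRt.2.2 u w i hw).2 hu, BruhatChain.iff_of_up hw, coeff_add, Nat.add_pos_iff_pos_or_pos,
      ih₂, or_comm]
    cases k with
    | zero => simp
    | succ k => simp [coeff_X_mul, ih₁]

theorem coeff_length_sub (hRt : IsRTildeFamily cs Rt) {u w : W} {k : ℕ}
    (h : BruhatChain cs k u w) : (Rt u w).coeff (cs.length w - cs.length u) = 1 := by
  induction u, w using cs.rightDescent_induction generalizing k with
  | one u =>
    obtain ⟨rfl, rfl⟩ := BruhatChain.right_one.1 h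
    simp [hRt.2.1]
  | down u w i hw hu ih =>
    rw [(hRt.2.2 u w i hw).1 hu, ← ih (h.mul_simple_of_lt_left hu)]
    have := cs.length_mul_simple u i
    have := cs.length_mul_simple w i
    congr 1
    omega
  | up u w i hw hu ih₁ _ =>
    obtain ⟨m, hm⟩ : ∃ m, BruhatChain cs m u (w * cs.simple i) := by
      rcases h.mul_simple_or i with h | ⟨k', -, h⟩
      · exact ⟨_, h.head (bruhatEdge_mul_simple hu)⟩
      · exact ⟨_, h⟩
    have hlu := cs.length_mul_simple u i
    have hlw := cs.length_mul_simple w i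
    obtain ⟨d, hd⟩ := hm.exists_length_eq
    have h0 : (Rt (u * cs.simple i) (w * cs.simple i)).coeff
        (cs.length w - cs.length u) = 0 := by
      by_contra hne
      obtain ⟨c, hc⟩ := ((hRt.coeff_pos_iff _ _ _).1 (Nat.pos_of_ne_zero hne)).exists_length_eq
      omega
    rw [(hRt.2.2 u w i hw).2 hu, coeff_add, h0, add_zero,
      show cs.length w - cs.length u = cs.length (w * cs.simple i) - cs.length u + 1 by omega,
      coeff_X_mul, ih₁ hm]

/-- The substitution relating `R`- and `R̃`-polynomials, with `q = x ^ 2`. -/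
theorem aeval_sq_mul_pow (hRt : IsRTildeFamily cs Rt) {R : W → W → ℤ[X]} (hR : IsRFamily cs R)
    {x : ℝ} (hx : x ≠ 0) (u w : W) :
    aeval (x ^ 2) (R u w) * x ^ cs.length u = x ^ cs.length w * aeval (x - x⁻¹) (Rt u w) := by
  induction u, w using cs.rightDescent_induction with
  | one u =>
    by_cases hu : u = 1
    · subst hu
      simp [hRt.2.1, hR.2.1]
    · have h : ¬ BruhatLE cs u 1 := fun h => hu h.eq_one
      simp [hRt.1 u 1 h, hR.1 u 1 h]
  | down u w i hw hu ih =>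
    rw [(hRt.2.2 u w i hw).1 hu, (hR.2.2 u w i hw).1 hu]
    have hlu : cs.length u = cs.length (u * cs.simple i) + 1 := by
      have := cs.length_mul_simple u i
      omega
    have hlw : cs.length w = cs.length (w * cs.simple i) + 1 := by
      have := cs.length_mul_simple w i
      omega
    rw [hlu, hlw, pow_succ x (cs.length _), pow_succ x (cs.length _)]
    linear_combination x * ih
  | up u w i hw hu ih₁ ih₂ =>
    rw [(hRt.2.2 u w i hw).2 hu, (hR.2.2 u w i hw).2 hu]
    have hlu : cs.length (u * cs.simple i) = cs.length u + 1 := by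
      have := cs.length_mul_simple u i
      omega
    have hlw : cs.length w = cs.length (w * cs.simple i) + 1 := by
      have := cs.length_mul_simple w i
      omega
    have hxx : x * x⁻¹ = 1 := mul_inv_cancel₀ hx
    rw [hlu, pow_succ x (cs.length _)] at ih₂
    rw [hlw, pow_succ x (cs.length _)]
    simp only [map_add, map_mul, map_sub, aeval_X, map_one]
    linear_combination (x ^ 2 - 1) * ih₁ + x * ih₂ -
      x ^ cs.length (w * cs.simple i) * aeval (x - x⁻¹) (Rt u (w * cs.simple i)) * -hxx

end IsRTildeFamily

end Bruhat

theorem stmt2 {B W : Type*} [Group W] [Finite W] {M : CoxeterMatrix B}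
    (cs : CoxeterSystem M W)
    (R : W → W → Polynomial ℤ) (hR : IsRFamily cs R)
    (Rt : W → W → Polynomial ℕ) (hRt : IsRTildeFamily cs Rt)
    (u w : W) (huw : BruhatLE cs u w) (hne : u ≠ w)
    (ℓ : ℕ) (hl : ℓ = cs.length w - cs.length u)
    (a : ℕ)
    (ha : IsLeast {k : ℕ | ∃ f : ℕ → W, f 0 = u ∧ f k = w ∧
      ∀ i < k, BruhatEdge cs (f i) (f (i + 1))} a) :
    a ≤ ℓ ∧ Even (ℓ - a) ∧
    (∀ i : ℕ, i ≤ (ℓ - a) / 2 → 0 < (Rt u w).coeff (a + 2 * i)) ∧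
    (∀ j : ℕ, (¬ ∃ i : ℕ, i ≤ (ℓ - a) / 2 ∧ j = a + 2 * i) → (Rt u w).coeff j = 0) ∧
    (Rt u w).coeff ℓ = 1 ∧
    R u w = ∑ i ∈ Finset.range ((ℓ - a) / 2 + 1),
      Polynomial.C ((Rt u w).coeff (a + 2 * i) : ℤ) *
        X ^ ((ℓ - a - 2 * i) / 2) * (X - 1) ^ (a + 2 * i) := by
  subst hl
  have hchain : BruhatChain cs a u w := BruhatChain.iff_exists_fun.2 ha.1
  obtain ⟨d, hd⟩ := hchain.exists_length_eq
  have hzero : ∀ j : ℕ, (¬ ∃ i : ℕ, i ≤ (cs.length w - cs.length u - a) / 2 ∧ j = a + 2 * i) →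
      (Rt u w).coeff j = 0 := by
    intro j hj
    by_contra hne
    have hc := (hRt.coeff_pos_iff u w j).1 (Nat.pos_of_ne_zero hne)
    have haj : a ≤ j := ha.2 (BruhatChain.iff_exists_fun.1 hc)
    obtain ⟨c, hc⟩ := hc.exists_length_eq
    exact hj ⟨(j - a) / 2, by omega, by omega⟩
  refine ⟨by omega, ⟨d, by omega⟩, fun i hi => ?_, hzero, hRt.coeff_length_sub hchain, ?_⟩
  · exact (hRt.coeff_pos_iff u w _).2 (hchain.add_two_mul i (by omega))
  have hd2 : (cs.length w - cs.length u - a) / 2 = d := by omega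
  rw [hd2] at hzero ⊢
  apply Polynomial.map_injective (Int.castRingHom ℝ) Int.cast_injective
  refine Polynomial.eq_of_infinite_eval_eq _ _ ((Set.Ioi_infinite (0 : ℝ)).mono fun y hy => ?_)
  obtain ⟨x, hx, rfl⟩ : ∃ x : ℝ, 0 < x ∧ x ^ 2 = y :=
    ⟨√y, Real.sqrt_pos.2 hy, Real.sq_sqrt (le_of_lt hy)⟩
  change eval (x ^ 2) _ = eval (x ^ 2) _
  rw [eval_map, eval_map]
  change aeval (x ^ 2) _ = aeval (x ^ 2) _
  have hRx := hRt.aeval_sq_mul_pow hR hx.ne' u w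
  apply mul_right_cancel₀ (pow_ne_zero (cs.length u) hx.ne')
  have hsum : aeval (x - x⁻¹) (Rt u w) = ∑ i ∈ Finset.range (d + 1),
      ((Rt u w).coeff (a + 2 * i) : ℝ) * (x - x⁻¹) ^ (a + 2 * i) := by
    rw [aeval_eq_sum_range' (n := max ((Rt u w).natDegree + 1) (a + 2 * d + 1)) (by omega)]
    rw [← Finset.sum_image (s := Finset.range (d + 1)) (g := fun i => a + 2 * i)
      (f := fun j => ((Rt u w).coeff j : ℝ) * (x - x⁻¹) ^ j) (fun i _ j _ h => by grind)]
    simp only [nsmul_eq_mul]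
    symm
    refine Finset.sum_subset (fun j hj => ?_) fun j _ hj => ?_
    · simp only [Finset.mem_image, Finset.mem_range] at hj ⊢
      omega
    · rw [hzero j fun ⟨i, hi, h⟩ => hj (Finset.mem_image.2 ⟨i, by simp; omega, h.symm⟩)]
      simp
  rw [hRx, hsum, map_sum, Finset.mul_sum, Finset.sum_mul]
  refine Finset.sum_congr rfl fun i hi => ?_
  have hi' : i ≤ d := by simpa [Nat.lt_succ_iff] using hi
  have hx2 : x ^ 2 - 1 = x * (x - x⁻¹) := by
    field_simp
  rw [show (cs.length w - cs.length u - a - 2 * i) / 2 = d - i by omega,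
    show cs.length w = 2 * (d - i) + (a + 2 * i) + cs.length u by omega]
  simp only [map_mul, map_pow, map_sub, aeval_X, map_one, hx2, mul_pow, pow_add, pow_mul,
    map_natCast]
  ring
end

section
/- Let (W,S) be a finite Coxeter system and R̃ its family of R̃-polynomials. If u ≤ v in Bruhat order, then q^{ℓ(u,v)} · R̃_{e,u}(q) ≤ R̃_{e,v}(q) coefficientwise; consequently, evaluating in the real numbers, R̃_{e,u}(1/√2) ≤ 2^{ℓ(u,v)/2} · R̃_{e,v}(1/√2). -/
open Polynomial

section

variable {B W : Type*} [Group W] {M : CoxeterMatrix B} (cs : CoxeterSystem M W)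

theorem BruhatLE.eq_or_length_lt {cs : CoxeterSystem M W} {u v : W} (h : BruhatLE cs u v) :
    u = v ∨ cs.length u < cs.length v := by
  induction h with
  | refl => exact Or.inl rfl
  | tail _ hbc ih =>
    obtain ⟨t, -, -, hlt⟩ := hbc
    rcases ih with rfl | ih
    · exact Or.inr hlt
    · exact Or.inr (ih.trans hlt)

namespace IsRTildeFamily

variable {cs} {Rt : W → W → Polynomial ℕ}

theorem eq_zero_of_length_le (hRt : IsRTildeFamily cs Rt) {u w : W} (hne : u ≠ w)
    (hle : cs.length w ≤ cs.length u) : Rt u w = 0 := by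
  refine hRt.1 u w fun h => ?_
  rcases h.eq_or_length_lt with h | h
  · exact hne h
  · omega

theorem apply_simple_mul (hRt : IsRTildeFamily cs Rt) (i : B) (n : ℕ) :
    ∀ x : W, cs.length x = n → cs.length x < cs.length (cs.simple i * x) →
      Rt x (cs.simple i * x) = X := by
  induction n with
  | zero =>
    intro x hx _
    obtain rfl := cs.length_eq_zero_iff.mp hx
    have h := (hRt.2.2 1 (cs.simple i) i (by simp)).2 (by simp)
    rw [cs.simple_mul_simple_self, hRt.2.1, one_mul,
      hRt.eq_zero_of_length_le (u := cs.simple i) (w := 1)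
        (fun h => by simpa [h] using cs.length_simple i) (by simp)] at h
    simpa using h
  | succ n ih =>
    intro x hx hlt
    obtain ⟨j, hj⟩ := cs.exists_rightDescent_of_ne_one (w := x) (by rintro rfl; simp at hx)
    have hj' := cs.isRightDescent_iff.mp hj
    have h1 := cs.length_simple_mul (x * cs.simple j) i
    have h2 := cs.length_simple_mul x i
    have h3 := cs.length_mul_simple (cs.simple i * x) j
    rw [mul_assoc] at h3
    rw [(hRt.2.2 x (cs.simple i * x) j (by rw [mul_assoc]; omega)).1 (by omega), mul_assoc]
    exact ih _ (by omega) (by omega)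

/-- The folding property of Coxeter groups, deduced from the existence of the `R̃`-polynomials. -/
theorem simple_mul_eq_mul_simple (hRt : IsRTildeFamily cs Rt) {x : W} {i j : B}
    (hi : cs.length x < cs.length (cs.simple i * x))
    (hj : cs.length x < cs.length (x * cs.simple j))
    (hij : cs.length (cs.simple i * x * cs.simple j) < cs.length (cs.simple i * x)) :
    cs.simple i * x = x * cs.simple j := by
  have h := (hRt.2.2 x (cs.simple i * x) j hij).2 hj
  have h2 := cs.length_simple_mul x i
  have h3 := cs.length_mul_simple (cs.simple i * x) j
  have h4 := cs.length_mul_simple x j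
  rw [hRt.apply_simple_mul i _ x rfl hi,
    hRt.eq_zero_of_length_le (u := x * cs.simple j) (w := cs.simple i * x * cs.simple j)
      (fun h => by rw [h] at h4; omega) (by omega)] at h
  by_contra hne
  rw [hRt.eq_zero_of_length_le (u := x) (w := cs.simple i * x * cs.simple j)
    (fun h => hne ((mul_eq_of_eq_mul_inv (by rw [cs.inv_simple]; exact h)).symm)) (by omega)] at h
  simp at h

end IsRTildeFamily

/-- Right multiplication by the inverse of a standard generator, in coordinates with respect to
the standard basis of the normalized Hecke algebra. -/
noncomputable def rightStep (i : B) (f : W → Polynomial ℕ) (x : W) : Polynomial ℕ :=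
  f (x * cs.simple i) + if cs.length x < cs.length (x * cs.simple i) then X * f x else 0

/-- Left multiplication by the inverse of a standard generator, in coordinates with respect to
the standard basis of the normalized Hecke algebra. -/
noncomputable def leftStep (i : B) (f : W → Polynomial ℕ) (x : W) : Polynomial ℕ :=
  f (cs.simple i * x) + if cs.length x < cs.length (cs.simple i * x) then X * f x else 0

open Classical in
/-- The coordinate at `x` of the product, over the letters of the word `ω`, of the inverses of the
standard generators of the normalized Hecke algebra. -/
noncomputable def wordPoly (ω : List B) : W → Polynomial ℕ :=
  ω.foldl (fun f i => rightStep cs i f) (Pi.single 1 1)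

theorem wordPoly_concat (ω : List B) (i : B) :
    wordPoly cs (ω ++ [i]) = rightStep cs i (wordPoly cs ω) := by
  simp [wordPoly]

open Classical in
theorem rightStep_single_one (i : B) :
    rightStep cs i (Pi.single 1 1) = leftStep cs i (Pi.single 1 1) := by
  funext x
  have h : x * cs.simple i = 1 ↔ cs.simple i * x = 1 := by
    rw [mul_eq_one_iff_eq_inv, mul_eq_one_iff_inv_eq, cs.inv_simple, eq_comm]
  by_cases hx : x = 1
  · simp [rightStep, leftStep, hx]
  · simp [rightStep, leftStep, Pi.single_apply, h, hx]

variable {cs} {Rt : W → W → Polynomial ℕ}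

theorem rightStep_leftStep_comm (hRt : IsRTildeFamily cs Rt) (i j : B) (f : W → Polynomial ℕ) :
    rightStep cs j (leftStep cs i f) = leftStep cs i (rightStep cs j f) := by
  funext x
  have h1 := cs.length_simple_mul x i
  have h2 := cs.length_mul_simple x j
  have h3 := cs.length_mul_simple (cs.simple i * x) j
  have h4 := cs.length_simple_mul (x * cs.simple j) i
  rw [← mul_assoc] at h4
  have up : cs.length x < cs.length (cs.simple i * x) →
      cs.length x < cs.length (x * cs.simple j) →
      cs.length (cs.simple i * x * cs.simple j) < cs.length (cs.simple i * x) →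
      cs.simple i * x = x * cs.simple j := hRt.simple_mul_eq_mul_simple
  have down : cs.length (cs.simple i * x) < cs.length x →
      cs.length (cs.simple i * x) < cs.length (cs.simple i * x * cs.simple j) →
      cs.length (x * cs.simple j) < cs.length x →
      cs.simple i * x = x * cs.simple j := by
    intro ha hb hc
    have := hRt.simple_mul_eq_mul_simple (x := cs.simple i * x) (i := i) (j := j)
      (by simpa using ha) hb (by simpa using hc)
    rw [cs.simple_mul_simple_cancel_left] at this
    conv_rhs => rw [this]
    rw [cs.simple_mul_simple_cancel_right]
  simp only [rightStep, leftStep, ← mul_assoc]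
  by_cases heq : cs.simple i * x = x * cs.simple j
  · simp only [heq]
  · have hiff : cs.length x < cs.length (x * cs.simple j) ↔
        cs.length (cs.simple i * x) < cs.length (cs.simple i * x * cs.simple j) := by
      constructor
      · intro h
        by_contra h'
        exact heq (up (by omega) h (by omega))
      · intro h
        by_contra h'
        exact heq (down (by omega) h (by omega))
    have hiff' : cs.length x < cs.length (cs.simple i * x) ↔
        cs.length (x * cs.simple j) < cs.length (cs.simple i * x * cs.simple j) := by
      omega
    simp only [← hiff, ← hiff']
    split_ifs <;> ring

theorem wordPoly_cons (hRt : IsRTildeFamily cs Rt) (i : B) (ω : List B) :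
    wordPoly cs (i :: ω) = leftStep cs i (wordPoly cs ω) := by
  induction ω using List.reverseRecOn with
  | nil => simpa [wordPoly] using rightStep_single_one cs i
  | append_singleton ω j ih =>
    rw [← List.cons_append, wordPoly_concat, wordPoly_concat, ih, rightStep_leftStep_comm hRt]

theorem wordPoly_cons_apply_one (hRt : IsRTildeFamily cs Rt) (i : B) (ω : List B) :
    wordPoly cs (i :: ω) 1 = wordPoly cs ω (cs.simple i) + X * wordPoly cs ω 1 := by
  simp [wordPoly_cons hRt, leftStep]

theorem wordPoly_append_comm_apply_one (hRt : IsRTildeFamily cs Rt) (ω ω' : List B) :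
    wordPoly cs (ω ++ ω') 1 = wordPoly cs (ω' ++ ω) 1 := by
  induction ω generalizing ω' with
  | nil => simp
  | cons i ω ih =>
    have h : wordPoly cs (i :: (ω ++ ω')) 1 = wordPoly cs ((ω ++ ω') ++ [i]) 1 := by
      rw [wordPoly_cons_apply_one hRt, wordPoly_concat]
      simp [rightStep]
    rw [List.cons_append, h, List.append_assoc, ih (ω' ++ [i])]
    simp

theorem exists_wordPoly_append_cons (hRt : IsRTildeFamily cs Rt) (ω ω' : List B) (i : B) :
    ∃ g, wordPoly cs (ω ++ i :: ω') 1 = X * wordPoly cs (ω ++ ω') 1 + g := by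
  refine ⟨wordPoly cs (ω' ++ ω) (cs.simple i), ?_⟩
  rw [wordPoly_append_comm_apply_one hRt ω, wordPoly_append_comm_apply_one hRt ω,
    List.cons_append, wordPoly_cons_apply_one hRt, add_comm]

theorem exists_wordPoly_of_sublist (hRt : IsRTildeFamily cs Rt) {ω' ω : List B}
    (h : ω'.Sublist ω) (p : List B) :
    ∃ g, wordPoly cs (p ++ ω) 1
      = X ^ (ω.length - ω'.length) * wordPoly cs (p ++ ω') 1 + g := by
  induction h generalizing p with
  | slnil => exact ⟨0, by simp⟩
  | @cons ω' ω i h ih =>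
    obtain ⟨g, hg⟩ := ih p
    obtain ⟨g', hg'⟩ := exists_wordPoly_append_cons hRt p ω i
    refine ⟨X * g + g', ?_⟩
    rw [hg', hg, List.length_cons, Nat.succ_sub h.length_le, pow_succ]
    ring
  | @cons_cons ω' ω i h ih =>
    obtain ⟨g, hg⟩ := ih (p ++ [i])
    exact ⟨g, by simpa using hg⟩

theorem exists_sublist_of_coeff_wordPoly_ne_zero (ω : List B) (x : W) (k : ℕ)
    (h : (wordPoly cs ω x).coeff k ≠ 0) :
    ∃ ω' : List B, ω'.Sublist ω ∧ ω'.length + k = ω.length ∧ cs.wordProd ω' = x := by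
  classical
  induction ω using List.reverseRecOn generalizing x k with
  | nil =>
    by_cases hx : x = 1
    · subst hx
      have hk : k = 0 := by
        by_contra hk
        simp [wordPoly, coeff_one, hk] at h
      exact ⟨[], by simp, by simp [hk], by simp⟩
    · simp [wordPoly, hx] at h
  | append_singleton ω i ih =>
    rw [wordPoly_concat, rightStep, coeff_add] at h
    by_cases h1 : (wordPoly cs ω (x * cs.simple i)).coeff k = 0
    · rw [h1, zero_add] at h
      split_ifs at h
      · cases k with
        | zero => simp at h
        | succ k =>
          rw [coeff_X_mul] at h
          obtain ⟨ω', hs, hl, hp⟩ := ih x k h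
          exact ⟨ω', hs.trans (List.sublist_append_left _ _), by simp; omega, hp⟩
      · simp at h
    · obtain ⟨ω', hs, hl, hp⟩ := ih _ k h1
      exact ⟨ω' ++ [i], hs.append (List.Sublist.refl _), by simp; omega,
        by simp [cs.wordProd_append, hp]⟩

namespace IsRTildeFamily

theorem eq_wordPoly (hRt : IsRTildeFamily cs Rt) {ω : List B} (hω : cs.IsReduced ω) (x : W) :
    Rt x (cs.wordProd ω) = wordPoly cs ω x := by
  classical
  induction ω using List.reverseRecOn generalizing x with
  | nil =>
    by_cases hx : x = 1
    · simp [wordPoly, hx, hRt.2.1]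
    · rw [cs.wordProd_nil, hRt.eq_zero_of_length_le hx (by simp)]
      simp [wordPoly, hx]
  | append_singleton ω i ih =>
    have hω' : cs.IsReduced ω := by simpa using hω.take ω.length
    have e : cs.wordProd (ω ++ [i]) = cs.wordProd ω * cs.simple i := by
      simp [cs.wordProd_append]
    have e' : cs.wordProd (ω ++ [i]) * cs.simple i = cs.wordProd ω := by simp [e]
    have hlt : cs.length (cs.wordProd (ω ++ [i]) * cs.simple i)
        < cs.length (cs.wordProd (ω ++ [i])) := by
      rw [e', hω.eq, hω'.eq]; simp
    have key := hRt.2.2 x _ i hlt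
    rw [e', ih hω', ih hω'] at key
    rw [wordPoly_concat, rightStep]
    have h2 := cs.length_mul_simple x i
    split_ifs with hx
    · rw [key.2 hx, add_comm]
    · rw [key.1 (by omega), add_zero]

theorem coeff_zero_eq_zero (hRt : IsRTildeFamily cs Rt) {x w : W} (hne : x ≠ w) :
    (Rt x w).coeff 0 = 0 := by
  obtain ⟨ω, hω, rfl⟩ := cs.exists_isReduced w
  rw [hRt.eq_wordPoly hω]
  by_contra h
  obtain ⟨ω', hs, hl, hp⟩ := exists_sublist_of_coeff_wordPoly_ne_zero ω x 0 h
  exact hne (by rw [← hp, hs.eq_of_length hl])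

theorem coeff_one_mul_simple_of_descent (hRt : IsRTildeFamily cs Rt) {x w : W} {i : B}
    (hne : x * cs.simple i ≠ w) (hw : cs.length (w * cs.simple i) < cs.length w) :
    (Rt (x * cs.simple i) (w * cs.simple i)).coeff 1 = (Rt x w).coeff 1 := by
  have hne' : x ≠ w * cs.simple i := fun h => hne (by rw [h, cs.simple_mul_simple_cancel_right])
  have h2 := cs.length_mul_simple x i
  by_cases hx : cs.length x < cs.length (x * cs.simple i)
  · rw [(hRt.2.2 x w i hw).2 hx, coeff_add, coeff_X_mul, hRt.coeff_zero_eq_zero hne', zero_add]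
  · rw [(hRt.2.2 x w i hw).1 (by omega)]

theorem coeff_one_mul_simple (hRt : IsRTildeFamily cs Rt) {x w : W} {i : B}
    (hne : x * cs.simple i ≠ w) :
    (Rt (x * cs.simple i) (w * cs.simple i)).coeff 1 = (Rt x w).coeff 1 := by
  have h2 := cs.length_mul_simple w i
  by_cases hw : cs.length (w * cs.simple i) < cs.length w
  · exact hRt.coeff_one_mul_simple_of_descent hne hw
  · have := hRt.coeff_one_mul_simple_of_descent (x := x * cs.simple i) (w := w * cs.simple i)
      (i := i) (fun h => hne (by
        rw [cs.simple_mul_simple_cancel_right] at h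
        rw [h, cs.simple_mul_simple_cancel_right]))
      (by rw [cs.simple_mul_simple_cancel_right]; omega)
    rw [cs.simple_mul_simple_cancel_right, cs.simple_mul_simple_cancel_right] at this
    exact this.symm

theorem coeff_one_add_coeff_one_mul (hRt : IsRTildeFamily cs Rt) (x w z : W) :
    (Rt (x * z) (w * z)).coeff 1 + (Rt (w * z) (x * z)).coeff 1
      = (Rt x w).coeff 1 + (Rt w x).coeff 1 := by
  induction z using cs.simple_induction_right with
  | one => simp
  | mul_simple_right z i ih =>
    rw [← ih, ← mul_assoc, ← mul_assoc]
    by_cases h : x * z * cs.simple i = w * z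
    · have h' : w * z * cs.simple i = x * z := by rw [← h, cs.simple_mul_simple_cancel_right]
      rw [h, h', add_comm]
    · rw [hRt.coeff_one_mul_simple h, hRt.coeff_one_mul_simple (fun h' => h (by
        rw [← h', cs.simple_mul_simple_cancel_right]))]

theorem coeff_one_mul_simple_self (hRt : IsRTildeFamily cs Rt) {x : W} {i : B}
    (h : cs.length x < cs.length (x * cs.simple i)) :
    (Rt x (x * cs.simple i)).coeff 1 = 1 := by
  rw [(hRt.2.2 x (x * cs.simple i) i (by simpa using h)).2 h, cs.simple_mul_simple_cancel_right,
    hRt.2.1, hRt.eq_zero_of_length_le (u := x * cs.simple i) (w := x)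
      (fun e => by rw [e] at h; omega) h.le]
  simp

theorem coeff_one_ne_zero_of_edge (hRt : IsRTildeFamily cs Rt) {u v : W}
    (h : BruhatEdge cs u v) : (Rt u v).coeff 1 ≠ 0 := by
  obtain ⟨t, ⟨w, i, rfl⟩, hv, hlt⟩ := h
  have key := hRt.coeff_one_add_coeff_one_mul u v w
  have e : v * w = u * w * cs.simple i := by rw [hv]; group
  rw [e, hRt.eq_zero_of_length_le (u := v) (w := u) (fun e => by rw [e] at hlt; omega) hlt.le,
    coeff_zero, add_zero] at key
  rw [← key]
  rcases cs.length_mul_simple (u * w) i with h | h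
  · rw [hRt.coeff_one_mul_simple_self (by omega)]
    omega
  · have := hRt.coeff_one_mul_simple_self (x := u * w * cs.simple i) (i := i)
      (by rw [cs.simple_mul_simple_cancel_right]; omega)
    rw [cs.simple_mul_simple_cancel_right] at this
    omega

/-- The strong exchange property, deduced from the existence of the `R̃`-polynomials. -/
theorem exists_sublist_of_edge (hRt : IsRTildeFamily cs Rt) {u : W} {ω : List B}
    (hω : cs.IsReduced ω) (h : BruhatEdge cs u (cs.wordProd ω)) :
    ∃ ω' : List B, ω'.Sublist ω ∧ ω'.length + 1 = ω.length ∧ cs.wordProd ω' = u := by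
  have := hRt.coeff_one_ne_zero_of_edge h
  rw [hRt.eq_wordPoly hω] at this
  exact exists_sublist_of_coeff_wordPoly_ne_zero ω u 1 this

/-- The deletion property, deduced from the existence of the `R̃`-polynomials. -/
theorem exists_reduced_sublist (hRt : IsRTildeFamily cs Rt) (ω : List B) :
    ∃ ω' : List B, ω'.Sublist ω ∧ cs.IsReduced ω' ∧ cs.wordProd ω' = cs.wordProd ω := by
  induction ω using List.reverseRecOn with
  | nil => exact ⟨[], List.Sublist.refl _, by simp [CoxeterSystem.IsReduced], rfl⟩
  | append_singleton ω i ih =>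
    obtain ⟨ω', hs, hr, hp⟩ := ih
    have e (ω : List B) : cs.wordProd (ω ++ [i]) = cs.wordProd ω * cs.simple i := by
      simp [cs.wordProd_append]
    have hl := hr.eq
    rcases cs.length_mul_simple (cs.wordProd ω') i with h | h
    · refine ⟨ω' ++ [i], hs.append (List.Sublist.refl _), ?_, by rw [e, e, hp]⟩
      rw [CoxeterSystem.IsReduced, e, h, hl]
      simp
    · obtain ⟨ω'', hs', hl', hp'⟩ := hRt.exists_sublist_of_edge (u := cs.wordProd ω' * cs.simple i)
        hr ⟨cs.simple i, cs.isReflection_simple i, by simp, by omega⟩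
      refine ⟨ω'', hs'.trans (hs.trans (List.sublist_append_left _ _)), ?_, by rw [hp', e, hp]⟩
      rw [CoxeterSystem.IsReduced, hp']
      omega

theorem exists_eq_of_edge (hRt : IsRTildeFamily cs Rt) {u v : W} (h : BruhatEdge cs u v) :
    ∃ g, Rt 1 v = X ^ (cs.length v - cs.length u) * Rt 1 u + g := by
  obtain ⟨ω, hω, rfl⟩ := cs.exists_isReduced v
  obtain ⟨ω', hs, -, rfl⟩ := hRt.exists_sublist_of_edge hω h
  obtain ⟨ω'', hs', hr, hp⟩ := hRt.exists_reduced_sublist ω'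
  obtain ⟨g, hg⟩ := exists_wordPoly_of_sublist hRt (hs'.trans hs) []
  refine ⟨g, ?_⟩
  rw [← hp, hRt.eq_wordPoly hω, hRt.eq_wordPoly hr, hω.eq, hr.eq]
  exact hg

theorem exists_eq_of_bruhatLE (hRt : IsRTildeFamily cs Rt) {u v : W} (h : BruhatLE cs u v) :
    ∃ g, Rt 1 v = X ^ (cs.length v - cs.length u) * Rt 1 u + g := by
  induction h with
  | refl => exact ⟨0, by simp⟩
  | @tail b c hab hbc ih =>
    obtain ⟨g, hg⟩ := ih
    obtain ⟨g', hg'⟩ := hRt.exists_eq_of_edge hbc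
    have hab' : cs.length u ≤ cs.length b := by
      rcases BruhatLE.eq_or_length_lt hab with rfl | h
      · exact le_rfl
      · exact h.le
    obtain ⟨t, -, -, hlt⟩ := hbc
    have e : cs.length c - cs.length u
        = (cs.length c - cs.length b) + (cs.length b - cs.length u) := by omega
    refine ⟨X ^ (cs.length c - cs.length b) * g + g', ?_⟩
    rw [hg', hg, e, pow_add]
    ring

end IsRTildeFamily

end

theorem Polynomial.aeval_nonneg_of_nat (p : Polynomial ℕ) {x : ℝ} (hx : 0 ≤ x) :
    0 ≤ aeval x p := by
  rw [aeval_eq_sum_range]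
  exact Finset.sum_nonneg fun i _ => nsmul_nonneg (pow_nonneg hx i) _

theorem stmt7 {B W : Type*} [Group W] [Finite W] {M : CoxeterMatrix B}
    (cs : CoxeterSystem M W)
    (Rt : W → W → Polynomial ℕ) (hRt : IsRTildeFamily cs Rt)
    (u v : W) (huv : BruhatLE cs u v) :
    (∀ m : ℕ,
      ((X : Polynomial ℕ) ^ (cs.length v - cs.length u) * Rt 1 u).coeff m
        ≤ (Rt 1 v).coeff m) ∧
    Polynomial.aeval (1 / Real.sqrt 2) (Rt 1 u)
      ≤ Real.sqrt 2 ^ (cs.length v - cs.length u)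
          * Polynomial.aeval (1 / Real.sqrt 2) (Rt 1 v) := by
  obtain ⟨g, hg⟩ := hRt.exists_eq_of_bruhatLE huv
  refine ⟨fun m => by rw [hg, coeff_add]; exact Nat.le_add_right _ _, ?_⟩
  have hs : (0 : ℝ) < Real.sqrt 2 := by positivity
  have hn := Polynomial.aeval_nonneg_of_nat g (x := 1 / Real.sqrt 2) (by positivity)
  rw [hg, map_add, map_mul, map_pow, aeval_X, mul_add, ← mul_assoc, ← mul_pow,
    mul_one_div_cancel hs.ne', one_pow, one_mul]
  exact le_add_of_nonneg_right (by positivity)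
end

section
/- Let (W,S) be a finite Coxeter system and R its family of R-polynomials, and let w ∈ W. If 2 · Σ_{v ≤ w} R′_{e,v}(2) ≠ ℓ(w) · Σ_{v ≤ w} R_{e,v}(2) (where R′ denotes the derivative, i.e. the average of the Bruhat–Poincaré polynomial P⃗_w(q) = Σ_{v ≤ w} R_{e,v}(q+1) differs from ℓ(w)/2), then the Bruhat graph on [e,w] is not regular. -/
open Polynomial

namespace CoxeterMatrix

variable {B : Type*} (M : CoxeterMatrix B)

/-- The Tits form on the free vector space on `B`. -/
noncomputable def titsForm : (B →₀ ℝ) →ₗ[ℝ] (B →₀ ℝ) →ₗ[ℝ] ℝ :=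
  Finsupp.linearCombination ℝ fun i ↦
    Finsupp.linearCombination ℝ fun j ↦ -Real.cos (Real.pi / M i j)

lemma titsForm_single (i j : B) :
    M.titsForm (Finsupp.single i 1) (Finsupp.single j 1) = -Real.cos (Real.pi / M i j) := by
  simp [titsForm]

lemma titsForm_single_self (i : B) :
    M.titsForm (Finsupp.single i 1) (Finsupp.single i 1) = 1 := by
  simp [titsForm_single]

lemma titsForm_comm (x y : B →₀ ℝ) : M.titsForm x y = M.titsForm y x := by
  induction x using Finsupp.induction_linear with
  | zero => simp
  | add x x' hx hx' => simp [hx, hx']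
  | single i a =>
    induction y using Finsupp.induction_linear with
    | zero => simp
    | add y y' hy hy' => simp [hy, hy']
    | single j b => simp [titsForm, M.symmetric i j]; ring

/-- The reflection of the geometric representation attached to a simple reflection. -/
noncomputable def simpleRefl (i : B) : (B →₀ ℝ) ≃ₗ[ℝ] (B →₀ ℝ) :=
  Module.reflection (x := Finsupp.single i (1 : ℝ)) (f := (2 : ℝ) • M.titsForm (Finsupp.single i 1))
    (by simp [titsForm_single_self])

lemma simpleRefl_apply (i : B) (x : B →₀ ℝ) :
    M.simpleRefl i x = x - (2 * M.titsForm (Finsupp.single i 1) x) • Finsupp.single i (1 : ℝ) := by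
  simp [simpleRefl, Module.reflection_apply]

lemma titsForm_simpleRefl (i : B) (x y : B →₀ ℝ) :
    M.titsForm (M.simpleRefl i x) (M.simpleRefl i y) = M.titsForm x y := by
  simp only [simpleRefl_apply, map_sub, map_smul, LinearMap.sub_apply, LinearMap.smul_apply,
    smul_eq_mul, titsForm_single_self, M.titsForm_comm x (Finsupp.single i 1)]
  ring

lemma two_le_of_ne {i j : B} (hij : i ≠ j) (h0 : M i j ≠ 0) : 2 ≤ M i j := by
  have := M.off_diagonal i j hij
  omega

lemma simpleRefl_isLiftable : M.IsLiftable M.simpleRefl := by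
  intro i j
  by_cases hij : i = j
  · subst hij
    rw [M.diagonal, pow_one]
    ext1 x
    exact Module.involutive_reflection (x := Finsupp.single i (1 : ℝ))
      (f := (2 : ℝ) • M.titsForm (Finsupp.single i 1)) _ x
  by_cases h0 : M i j = 0
  · simp [h0]
  have h2 := M.two_le_of_ne hij h0
  ext1 z
  have hc : M.titsForm (Finsupp.single i 1) (Finsupp.single j 1) = -Real.cos (Real.pi / M i j) :=
    M.titsForm_single i j
  have hc' : M.titsForm (Finsupp.single j 1) (Finsupp.single i 1) =
      -Real.cos (Real.pi / M i j) := by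
    rw [M.titsForm_comm, hc]
  rw [simpleRefl, simpleRefl, Module.reflection_mul_reflection_pow_apply _ _ _ _
    (2 * Real.cos (2 * (Real.pi / M i j))) (by
      simp only [LinearMap.smul_apply, hc, hc', Real.cos_two_mul, smul_eq_mul]; ring)]
  rcases h2.eq_or_lt with h2 | h2
  · rw [← h2] at hc hc' ⊢
    have e1 : (((2 : ℕ) : ℤ) - 2) / 2 = 0 := by norm_num
    have e2 : (((2 : ℕ) : ℤ) - 1) / 2 = 0 := by norm_num
    have e3 : (((2 : ℕ) : ℤ) - 3) / 2 = -1 := by norm_num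
    have e4 : (((2 : ℕ) : ℤ)) / 2 = 1 := by norm_num
    have e5 : (2 : ℝ) * (Real.pi / (2 : ℕ)) = Real.pi := by push_cast; ring
    rw [e1, e2, e3, e4, e5]
    simp only [Nat.cast_ofNat, Real.cos_pi_div_two, neg_zero] at hc hc'
    simp [hc, hc']
    module
  set m := M i j with hm
  set θ : ℝ := Real.pi / m with hθ
  have hm0 : (m : ℝ) ≠ 0 := by exact_mod_cast h0
  have hmθ : (m : ℝ) * θ = Real.pi := by rw [hθ]; field_simp
  have hs : Real.sin (2 * θ) ≠ 0 := by
    apply ne_of_gt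
    apply Real.sin_pos_of_pos_of_lt_pi
    · have := Real.pi_pos; positivity
    · rw [hθ, ← mul_div_assoc, div_lt_iff₀ (by positivity)]
      have : (2 : ℝ) < m := by exact_mod_cast h2
      nlinarith [Real.pi_pos]
  have hS := Polynomial.Chebyshev.S_two_mul_real_cos (2 * θ)
  rcases Nat.even_or_odd' m with ⟨k, hk | hk⟩
  · have e1 : ((m : ℤ) - 2) / 2 = k - 1 := by omega
    have e2 : ((m : ℤ) - 1) / 2 = k - 1 := by omega
    have hk' : (m : ℝ) = 2 * k := by exact_mod_cast hk
    have h1 : (Polynomial.Chebyshev.S ℝ ((k : ℤ) - 1)).eval (2 * Real.cos (2 * θ)) = 0 := by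
      apply (mul_eq_zero.mp _).resolve_right hs
      rw [hS]
      have : (((((k : ℤ) - 1 : ℤ)) : ℝ) + 1) * (2 * θ) = Real.pi := by
        push_cast; rw [← hmθ, hk']; ring
      rw [this, Real.sin_pi]
    rw [e1, e2, h1]
    simp
  · have e1 : ((m : ℤ) - 2) / 2 = k - 1 := by omega
    have e2 : ((m : ℤ) - 1) / 2 = k := by omega
    have e3 : ((m : ℤ) - 3) / 2 = k - 1 := by omega
    have e4 : (m : ℤ) / 2 = k := by omega
    have hk' : (m : ℝ) = 2 * k + 1 := by exact_mod_cast hk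
    have h1 : (Polynomial.Chebyshev.S ℝ (k : ℤ)).eval (2 * Real.cos (2 * θ))
        + (Polynomial.Chebyshev.S ℝ ((k : ℤ) - 1)).eval (2 * Real.cos (2 * θ)) = 0 := by
      apply (mul_eq_zero.mp _).resolve_right hs
      rw [add_mul, hS, hS]
      have a1 : (((k : ℤ) : ℝ) + 1) * (2 * θ) = Real.pi + θ := by
        push_cast; rw [← hmθ, hk']; ring
      have a2 : (((((k : ℤ) - 1 : ℤ)) : ℝ) + 1) * (2 * θ) = Real.pi - θ := by
        push_cast; rw [← hmθ, hk']; ring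
      rw [a1, a2, Real.sin_pi_sub, add_comm Real.pi, Real.sin_add_pi]; ring
    rw [e1, e2, e3, e4, h1]
    simp

end CoxeterMatrix

namespace CoxeterSystem

variable {B W : Type*} [Group W] {M : CoxeterMatrix B} (cs : CoxeterSystem M W)

/-- The geometric representation of a Coxeter group. -/
noncomputable def geomRep : W →* ((B →₀ ℝ) ≃ₗ[ℝ] (B →₀ ℝ)) :=
  cs.lift ⟨M.simpleRefl, M.simpleRefl_isLiftable⟩

lemma geomRep_simple_apply (i : B) (x : B →₀ ℝ) :
    cs.geomRep (cs.simple i) x =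
      x - (2 * M.titsForm (Finsupp.single i 1) x) • Finsupp.single i (1 : ℝ) := by
  rw [geomRep, cs.lift_apply_simple, M.simpleRefl_apply]

lemma titsForm_geomRep (w : W) (x y : B →₀ ℝ) :
    M.titsForm (cs.geomRep w x) (cs.geomRep w y) = M.titsForm x y := by
  induction w using cs.simple_induction_left with
  | one => simp
  | mul_simple_left w i ih =>
    rw [map_mul, LinearEquiv.mul_apply, LinearEquiv.mul_apply, geomRep, cs.lift_apply_simple,
      M.titsForm_simpleRefl]
    exact ih

lemma geomRep_simple_self (i : B) :
    cs.geomRep (cs.simple i) (Finsupp.single i 1) = -Finsupp.single i (1 : ℝ) := by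
  rw [geomRep_simple_apply, M.titsForm_single_self]
  module

lemma geomRep_alternatingWord (i j : B) (k : ℕ) :
    cs.geomRep (cs.wordProd (alternatingWord i j k)) (Finsupp.single i 1) =
      (Chebyshev.S ℝ k).eval (2 * Real.cos (Real.pi / M i j)) •
        Finsupp.single (if Even k then i else j) (1 : ℝ) +
      (Chebyshev.S ℝ ((k : ℤ) - 1)).eval (2 * Real.cos (Real.pi / M i j)) •
        Finsupp.single (if Even k then j else i) (1 : ℝ) := by
  induction k with
  | zero => simp [alternatingWord]
  | succ k ih =>
    rw [alternatingWord_succ', wordProd_cons, map_mul, LinearEquiv.mul_apply, ih]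
    have hS : (Chebyshev.S ℝ ((k + 1 : ℕ) : ℤ)).eval (2 * Real.cos (Real.pi / M i j)) =
        (2 * Real.cos (Real.pi / M i j)) *
          (Chebyshev.S ℝ k).eval (2 * Real.cos (Real.pi / M i j)) -
          (Chebyshev.S ℝ ((k : ℤ) - 1)).eval (2 * Real.cos (Real.pi / M i j)) := by
      push_cast
      rw [Chebyshev.S_add_one]
      simp
    have hk : (((k + 1 : ℕ) : ℤ) - 1) = k := by simp
    rw [hS, hk]
    by_cases h : Even k
    · have h' : ¬ Even (k + 1) := by simpa [Nat.even_add_one] using h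
      simp only [h, h', if_true, if_false, map_add, map_smul, geomRep_simple_self,
        geomRep_simple_apply _ j (Finsupp.single i 1), M.titsForm_single, M.symmetric j i]
      module
    · have h' : Even (k + 1) := by simpa [Nat.even_add_one] using h
      simp only [h, h', if_true, if_false, map_add, map_smul, geomRep_simple_self,
        geomRep_simple_apply _ i (Finsupp.single j 1), M.titsForm_single]
      module

lemma eval_S_two_mul_cos_nonneg {m k : ℕ} (hm : m ≠ 1) (hk : k ≤ m ∨ m = 0) :
    0 ≤ (Chebyshev.S ℝ ((k : ℤ) - 1)).eval (2 * Real.cos (Real.pi / m)) := by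
  rcases eq_or_ne m 0 with rfl | h0
  · simp
  have hk : k ≤ m := by tauto
  have hm2 : (2 : ℝ) ≤ m := by exact_mod_cast (show 2 ≤ m by omega)
  have hS := Chebyshev.S_two_mul_real_cos (Real.pi / m) ((k : ℤ) - 1)
  have hpos : 0 < Real.sin (Real.pi / m) := by
    apply Real.sin_pos_of_pos_of_lt_pi
    · have := Real.pi_pos; positivity
    · rw [div_lt_iff₀ (by positivity)]
      nlinarith [Real.pi_pos]
  refine nonneg_of_mul_nonneg_left ?_ hpos
  rw [hS]
  have hkm : (k : ℝ) ≤ m := by exact_mod_cast hk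
  push_cast
  apply Real.sin_nonneg_of_nonneg_of_le_pi
  · have := Real.pi_pos
    have : (0:ℝ) ≤ k := by positivity
    rw [sub_add_cancel]
    positivity
  · rw [sub_add_cancel, ← mul_div_assoc, div_le_iff₀ (by positivity)]
    nlinarith [Real.pi_pos]

/-- `w` sends the simple root at `i` to a positive root as soon as `i` is not a right descent. -/
theorem geomRep_single_nonneg (w : W) (i : B) (hw : cs.length w < cs.length (w * cs.simple i)) :
    0 ≤ cs.geomRep w (Finsupp.single i 1) := by
  induction hn : cs.length w using Nat.strong_induction_on generalizing w i with
  | _ n ih =>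
  subst hn
  rcases eq_or_ne w 1 with rfl | hw1
  · simp
  obtain ⟨j, hj⟩ := cs.exists_rightDescent_of_ne_one hw1
  have hij : i ≠ j := by rintro rfl; exact (lt_asymm hw hj).elim
  let P : ℕ → Prop := fun k ↦ ∃ v, w = v * cs.wordProd (alternatingWord i j k) ∧
    cs.length v + k = cs.length w
  have P1 : P 1 := ⟨w * cs.simple j, by simp [alternatingWord], by
    rwa [cs.isRightDescent_iff] at hj⟩
  have Pdown : ∀ k, P (k + 1) → P k := by
    rintro k ⟨v, hv, hl⟩
    rw [alternatingWord_succ', wordProd_cons, ← mul_assoc] at hv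
    refine ⟨_, hv, ?_⟩
    have h1 := cs.length_mul_simple v (if Even k then j else i)
    have h2 := cs.length_mul_le (v * cs.simple (if Even k then j else i))
      (cs.wordProd (alternatingWord i j k))
    have h3 := cs.length_wordProd_le (alternatingWord i j k)
    rw [← hv] at h2
    rw [length_alternatingWord] at h3
    omega
  have Pm : M i j ≠ 0 → ¬ P (M i j) := by
    rintro h0 ⟨v, hv, hl⟩
    have hbr := cs.wordProd_braidWord_eq i j
    rw [braidWord, braidWord] at hbr
    obtain ⟨m, hm⟩ := Nat.exists_eq_succ_of_ne_zero h0
    rw [hbr, M.symmetric j i, hm, alternatingWord_succ, wordProd_concat, ← mul_assoc] at hv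
    have h2 := cs.length_mul_le v (cs.wordProd (alternatingWord i j m))
    have h3 := cs.length_wordProd_le (alternatingWord i j m)
    rw [length_alternatingWord] at h3
    have : w * cs.simple i = v * cs.wordProd (alternatingWord i j m) := by rw [hv]; simp
    rw [this] at hw
    omega
  have Pbd : ∀ k, P k → k ≤ cs.length w := by rintro k ⟨v, -, h⟩; omega
  classical
  have hmax : ∃ k, 1 ≤ k ∧ P k ∧ ¬ P (k + 1) := by
    by_contra! hcon
    have : ∀ k, P (k + 1) := fun k ↦ by
      induction k with
      | zero => exact P1
      | succ k ihk => exact hcon _ (by omega) ihk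
    have := Pbd _ (this (cs.length w))
    omega
  obtain ⟨k, hk1, ⟨v, hv, hl⟩, hPk⟩ := hmax
  have hPle : ∀ a b, P (a + b) → P a := by
    intro a b
    induction b with
    | zero => exact id
    | succ b ihb => exact fun h ↦ ihb (Pdown _ h)
  have hkm : k < M i j ∨ M i j = 0 := by
    by_contra! hcon
    obtain ⟨d, hd⟩ := Nat.exists_eq_add_of_le hcon.1
    exact Pm hcon.2 (hPle _ d (hd ▸ ⟨v, hv, hl⟩))
  have hm1 : M i j ≠ 1 := M.off_diagonal i j hij
  have hv1 : cs.length v < cs.length (v * cs.simple (if Even k then j else i)) := by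
    by_contra! hcon
    apply hPk
    refine ⟨v * cs.simple (if Even k then j else i), ?_, ?_⟩
    · rw [alternatingWord_succ', wordProd_cons]; simpa [mul_assoc] using hv
    · have := cs.length_mul_simple v (if Even k then j else i)
      omega
  have hv2 : cs.length v < cs.length (v * cs.simple (if Even k then i else j)) := by
    by_contra! hcon
    obtain ⟨l, rfl⟩ : ∃ l, k = l + 1 := ⟨k - 1, by omega⟩
    have e : (if Even (l + 1) then i else j) = if Even l then j else i := by
      simp only [Nat.even_add_one]; split_ifs <;> simp_all
    rw [e] at hcon
    rw [alternatingWord_succ', wordProd_cons, ← mul_assoc] at hv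
    have h2 := cs.length_mul_le (v * cs.simple (if Even l then j else i))
      (cs.wordProd (alternatingWord i j l))
    have h3 := cs.length_wordProd_le (alternatingWord i j l)
    have h4 := cs.length_mul_simple v (if Even l then j else i)
    rw [← hv] at h2
    rw [length_alternatingWord] at h3
    omega
  rw [hv, map_mul, LinearEquiv.mul_apply, geomRep_alternatingWord, map_add, map_smul, map_smul]
  apply add_nonneg
  · apply smul_nonneg
    · simpa using eval_S_two_mul_cos_nonneg (k := k + 1) hm1 (by omega)
    · exact ih _ (by omega) _ _ hv2 rfl
  · apply smul_nonneg
    · exact eval_S_two_mul_cos_nonneg hm1 (by omega)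
    · exact ih _ (by omega) _ _ hv1 rfl

end CoxeterSystem

namespace CoxeterSystem

variable {B W : Type*} [Group W] {M : CoxeterMatrix B} (cs : CoxeterSystem M W)

lemma geomRep_mul_simple_single (w : W) (i : B) :
    cs.geomRep (w * cs.simple i) (Finsupp.single i 1) = -cs.geomRep w (Finsupp.single i 1) := by
  rw [map_mul, LinearEquiv.mul_apply, geomRep_simple_self, map_neg]

lemma geomRep_single_nonneg_or (w : W) (i : B) :
    0 ≤ cs.geomRep w (Finsupp.single i 1) ∨ cs.geomRep w (Finsupp.single i 1) ≤ 0 := by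
  rcases lt_or_gt_of_ne (cs.length_mul_simple_ne w i) with h | h
  · right
    have := cs.geomRep_single_nonneg (w * cs.simple i) i (by simpa using h)
    rwa [geomRep_mul_simple_single, Left.nonneg_neg_iff] at this
  · exact .inl (cs.geomRep_single_nonneg w i h)

open Classical in
/-- The positive root of a reflection. -/
noncomputable def root (t : W) : B →₀ ℝ :=
  if h : ∃ p : W × B, t = p.1 * cs.simple p.2 * p.1⁻¹ ∧
      0 ≤ cs.geomRep p.1 (Finsupp.single p.2 1) then
    cs.geomRep h.choose.1 (Finsupp.single h.choose.2 1) else 0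

variable {cs}

lemma IsReflection.exists_root_eq {t : W} (ht : cs.IsReflection t) :
    ∃ u i, t = u * cs.simple i * u⁻¹ ∧ cs.root t = cs.geomRep u (Finsupp.single i 1) ∧
      0 ≤ cs.root t := by
  have h : ∃ p : W × B, t = p.1 * cs.simple p.2 * p.1⁻¹ ∧
      0 ≤ cs.geomRep p.1 (Finsupp.single p.2 1) := by
    obtain ⟨u, i, rfl⟩ := ht
    rcases cs.geomRep_single_nonneg_or u i with h | h
    · exact ⟨(u, i), rfl, h⟩
    · refine ⟨(u * cs.simple i, i), by simp [mul_assoc], ?_⟩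
      rw [geomRep_mul_simple_single]
      exact Left.nonneg_neg_iff.2 h
  have e : cs.root t = cs.geomRep h.choose.1 (Finsupp.single h.choose.2 1) := by
    rw [root, dif_pos h]
  exact ⟨_, _, h.choose_spec.1, e, e ▸ h.choose_spec.2⟩

variable (cs) in
lemma root_nonneg (t : W) : 0 ≤ cs.root t := by
  rw [root]
  split_ifs with h
  · exact h.choose_spec.2
  · rfl

lemma IsReflection.titsForm_root_self {t : W} (ht : cs.IsReflection t) :
    M.titsForm (cs.root t) (cs.root t) = 1 := by
  obtain ⟨u, i, -, h, -⟩ := ht.exists_root_eq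
  rw [h, titsForm_geomRep, M.titsForm_single_self]

lemma IsReflection.root_ne_zero {t : W} (ht : cs.IsReflection t) : cs.root t ≠ 0 := by
  intro h
  simpa [h] using ht.titsForm_root_self

lemma IsReflection.geomRep_apply {t : W} (ht : cs.IsReflection t) (x : B →₀ ℝ) :
    cs.geomRep t x = x - (2 * M.titsForm (cs.root t) x) • cs.root t := by
  obtain ⟨u, i, rfl, h, -⟩ := ht.exists_root_eq
  rw [h, map_mul, map_mul, LinearEquiv.mul_apply, LinearEquiv.mul_apply, geomRep_simple_apply,
    map_sub, map_smul, ← cs.titsForm_geomRep u, ← LinearEquiv.mul_apply, ← map_mul]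
  simp

lemma IsReflection.geomRep_root_self {t : W} (ht : cs.IsReflection t) :
    cs.geomRep t (cs.root t) = -cs.root t := by
  rw [ht.geomRep_apply, ht.titsForm_root_self]
  module

variable (cs) in
lemma geomRep_injective : Function.Injective cs.geomRep := by
  rw [injective_iff_map_eq_one]
  intro w hw
  by_contra h
  obtain ⟨i, hi⟩ := cs.exists_rightDescent_of_ne_one h
  have h1 := cs.geomRep_single_nonneg (w * cs.simple i) i
    (by simpa [IsRightDescent] using hi)
  rw [geomRep_mul_simple_single, hw] at h1
  have := h1 i
  simp at this
  linarith

lemma IsReflection.eq_of_root_eq_smul {t t' : W} (ht : cs.IsReflection t)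
    (ht' : cs.IsReflection t') {c : ℝ} (h : cs.root t = c • cs.root t') : t = t' := by
  apply cs.geomRep_injective
  ext1 x
  have h1 := ht.titsForm_root_self
  rw [h] at h1
  simp only [map_smul, LinearMap.smul_apply, ht'.titsForm_root_self, smul_eq_mul] at h1
  rw [ht.geomRep_apply, ht'.geomRep_apply, h]
  simp only [map_smul, LinearMap.smul_apply, smul_eq_mul, smul_smul]
  congr 2
  linear_combination (2 * M.titsForm (cs.root t') x) * h1

lemma IsReflection.eq_root_or {t : W} (ht : cs.IsReflection t) {x : B →₀ ℝ}
    (h1 : M.titsForm x x = 1) (h : cs.geomRep t x = -x) : x = cs.root t ∨ x = -cs.root t := by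
  rw [ht.geomRep_apply] at h
  have hx : x = M.titsForm (cs.root t) x • cs.root t := by
    have : (2 : ℝ) • x = (2 : ℝ) • M.titsForm (cs.root t) x • cs.root t := by
      rw [smul_smul, two_smul]
      nth_rewrite 1 [← neg_neg x]
      rw [← h]
      module
    exact smul_right_injective _ two_ne_zero this
  generalize M.titsForm (cs.root t) x = c at hx
  subst hx
  simp only [map_smul, LinearMap.smul_apply, ht.titsForm_root_self, smul_eq_mul] at h1
  have : (c - 1) * (c + 1) = 0 := by linear_combination h1
  rcases mul_eq_zero.1 this with h | h
  · left; rw [show c = 1 by linarith, one_smul]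
  · right; rw [show c = -1 by linarith, neg_one_smul]

lemma IsReflection.geomRep_root_or {t : W} (ht : cs.IsReflection t) (w : W) :
    cs.geomRep w (cs.root t) = cs.root (w * t * w⁻¹) ∨
      cs.geomRep w (cs.root t) = -cs.root (w * t * w⁻¹) := by
  apply (ht.conj w).eq_root_or
  · rw [titsForm_geomRep, ht.titsForm_root_self]
  · rw [← map_neg, ← ht.geomRep_root_self, ← LinearEquiv.mul_apply, ← map_mul,
      ← LinearEquiv.mul_apply, ← map_mul]
    simp

variable (cs) in
lemma root_simple (i : B) : cs.root (cs.simple i) = Finsupp.single i 1 := by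
  rcases (cs.isReflection_simple i).eq_root_or (M.titsForm_single_self i)
    (cs.geomRep_simple_self i) with h | h
  · exact h.symm
  · have h1 := DFunLike.congr_fun h i
    have h2 := cs.root_nonneg (cs.simple i) i
    simp at h1 h2
    linarith

lemma IsReflection.geomRep_simple_root {t : W} (ht : cs.IsReflection t) {i : B}
    (hi : t ≠ cs.simple i) :
    cs.geomRep (cs.simple i) (cs.root t) = cs.root (cs.simple i * t * cs.simple i) := by
  rcases ht.geomRep_root_or (cs.simple i) with h | h
  · simpa using h
  · refine (hi ?_).elim
    apply ht.eq_of_root_eq_smul (cs.isReflection_simple i) (c := cs.root t i)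
    ext j
    rw [root_simple]
    rcases eq_or_ne i j with rfl | hj
    · simp
    · have h1 := DFunLike.congr_fun h j
      have h2 := cs.root_nonneg t j
      have h3 := cs.root_nonneg (cs.simple i * t * (cs.simple i)⁻¹) j
      rw [geomRep_simple_apply] at h1
      simp [hj] at h1 h2 h3 ⊢
      linarith

lemma IsReflection.length_mul_lt_of_geomRep_root {t : W} (ht : cs.IsReflection t) {w : W}
    (h : cs.geomRep w (cs.root t) = -cs.root (w * t * w⁻¹)) :
    cs.length (w * t) < cs.length w := by
  induction hn : cs.length w using Nat.strong_induction_on generalizing w with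
  | _ n ih =>
  subst hn
  rcases eq_or_ne w 1 with rfl | hw
  · simp only [one_mul, inv_one, mul_one, map_one, LinearEquiv.coe_one, id_eq] at h
    exact (ht.root_ne_zero (self_eq_neg.1 h)).elim
  obtain ⟨i, hi⟩ := cs.exists_leftDescent_of_ne_one hw
  have hi1 := (cs.isLeftDescent_iff).1 hi
  have hw' : w = cs.simple i * (cs.simple i * w) := by simp
  rcases ht.geomRep_root_or (cs.simple i * w) with h1 | h1
  · by_cases h2 : cs.simple i * w * t * (cs.simple i * w)⁻¹ = cs.simple i
    · have : cs.simple i * w = w * t := by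
        have h3 := mul_inv_eq_iff_eq_mul.1 h2
        rw [mul_assoc, mul_right_inj] at h3
        exact h3.symm
      rw [← this]
      omega
    · have h3 := (ht.conj (cs.simple i * w)).geomRep_simple_root h2
      rw [← h1, ← LinearEquiv.mul_apply, ← map_mul, ← hw', h] at h3
      have h4 : w * t * w⁻¹ =
        cs.simple i * (cs.simple i * w * t * (cs.simple i * w)⁻¹) * cs.simple i := by
        simp [mul_assoc]
      rw [← h4] at h3
      exact ((ht.conj w).root_ne_zero (self_eq_neg.1 h3.symm)).elim
  · have h2 := ih _ (by omega) h1 rfl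
    have h3 := cs.length_simple_mul (cs.simple i * w * t) i
    rw [mul_assoc, ← mul_assoc (cs.simple i) (cs.simple i), cs.simple_mul_simple_self,
      one_mul] at h3
    rw [mul_assoc] at h2
    omega

lemma IsReflection.geomRep_root_eq_neg_iff {t : W} (ht : cs.IsReflection t) (w : W) :
    cs.geomRep w (cs.root t) = -cs.root (w * t * w⁻¹) ↔ cs.length (w * t) < cs.length w := by
  refine ⟨ht.length_mul_lt_of_geomRep_root, fun h ↦ ?_⟩
  refine (ht.geomRep_root_or w).resolve_left fun h1 ↦ ?_
  have h2 : cs.length (w * t * t) < cs.length (w * t) := by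
    apply ht.length_mul_lt_of_geomRep_root
    rw [map_mul, LinearEquiv.mul_apply, ht.geomRep_root_self, map_neg, h1]
    simp [mul_assoc]
  rw [mul_assoc, ht.mul_self, mul_one] at h2
  omega

lemma IsReflection.geomRep_root_eq_iff {t : W} (ht : cs.IsReflection t) (w : W) :
    cs.geomRep w (cs.root t) = cs.root (w * t * w⁻¹) ↔ cs.length w < cs.length (w * t) := by
  have h1 := ht.geomRep_root_eq_neg_iff w
  have h2 := ht.geomRep_root_or w
  have h3 := ht.length_mul_left_ne w
  constructor
  · intro h
    by_contra! hc
    have := h1.2 (by omega)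
    rw [h] at this
    exact (ht.conj w).root_ne_zero (self_eq_neg.1 this)
  · intro h
    exact h2.resolve_right fun h' ↦ by have := h1.1 h'; omega

lemma IsReflection.length_simple_mul_mul_lt_iff {t : W} (ht : cs.IsReflection t) {u : W} {i : B}
    (h : u * t ≠ cs.simple i * u) :
    cs.length (cs.simple i * u * t) < cs.length (cs.simple i * u) ↔
      cs.length (u * t) < cs.length u := by
  have h1 : u * t * u⁻¹ ≠ cs.simple i := fun h' ↦ h (mul_inv_eq_iff_eq_mul.1 h')
  have h2 := (ht.conj u).geomRep_simple_root h1
  have h3 : cs.simple i * u * t * (cs.simple i * u)⁻¹ =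
    cs.simple i * (u * t * u⁻¹) * cs.simple i := by simp [mul_assoc]
  rw [← ht.geomRep_root_eq_neg_iff, ← ht.geomRep_root_eq_neg_iff, h3, ← h2, map_mul,
    LinearEquiv.mul_apply, ← map_neg, (cs.geomRep (cs.simple i)).injective.eq_iff]

lemma IsReflection.length_mul_mul_simple_lt_iff {t : W} (ht : cs.IsReflection t) {u : W} {i : B}
    (h : t * u ≠ u * cs.simple i) :
    cs.length (t * (u * cs.simple i)) < cs.length (u * cs.simple i) ↔
      cs.length (t * u) < cs.length u := by
  have := ht.length_simple_mul_mul_lt_iff (u := u⁻¹) (i := i) (fun h' ↦ h ?_)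
  · rw [← cs.length_inv (t * (u * _)), ← cs.length_inv (u * _), ← cs.length_inv (t * u),
      ← cs.length_inv u]
    simpa [ht.inv] using this
  · rw [← inv_inj]
    simpa [ht.inv] using h'

end CoxeterSystem

namespace CoxeterSystem

section Bruhat

variable {B W : Type*} [Group W] {M : CoxeterMatrix B} {cs : CoxeterSystem M W}

lemma bruhatEdge_mul_left {t v : W} (ht : cs.IsReflection t)
    (h : cs.length v < cs.length (t * v)) : BruhatEdge cs v (t * v) :=
  ⟨v⁻¹ * t * v, by simpa using ht.conj v⁻¹, by simp [mul_assoc], h⟩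

lemma bruhatEdge_of_mul_left {t v : W} (ht : cs.IsReflection t)
    (h : cs.length (t * v) < cs.length v) : BruhatEdge cs (t * v) v := by
  have h1 := bruhatEdge_mul_left (v := t * v) ht
  rw [← mul_assoc, ht.mul_self, one_mul] at h1
  exact h1 h

lemma bruhatEdge_iff {x y : W} :
    BruhatEdge cs x y ↔ ∃ t, cs.IsReflection t ∧ y = t * x ∧ cs.length x < cs.length y := by
  constructor
  · rintro ⟨t, ht, rfl, h⟩
    exact ⟨x * t * x⁻¹, ht.conj x, by simp, h⟩
  · rintro ⟨t, ht, rfl, h⟩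
    exact bruhatEdge_mul_left ht h

lemma bruhatEdge_mul_simple_of_lt {w : W} {i : B} (h : cs.length w < cs.length (w * cs.simple i)) :
    BruhatEdge cs w (w * cs.simple i) :=
  ⟨_, cs.isReflection_simple i, rfl, h⟩

lemma _root_.BruhatEdge.mul_simple_s9 {x y : W} (h : BruhatEdge cs x y) (i : B) :
    y = x * cs.simple i ∨ BruhatEdge cs (x * cs.simple i) (y * cs.simple i) := by
  obtain ⟨t, ht, rfl, hl⟩ := h
  rcases eq_or_ne t (cs.simple i) with rfl | hti
  · exact .inl rfl
  right
  have ht' : cs.IsReflection (cs.simple i * t * cs.simple i) := by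
    simpa using ht.conj (cs.simple i)
  refine ⟨cs.simple i * t * cs.simple i, ht', by simp [mul_assoc], ?_⟩
  have h1 : x * t * cs.simple i = x * cs.simple i * (cs.simple i * t * cs.simple i) := by
    simp [mul_assoc]
  rw [h1, ← ht'.geomRep_root_eq_iff, ← ht.geomRep_simple_root hti, ← LinearEquiv.mul_apply,
    ← map_mul, mul_assoc, cs.simple_mul_simple_self, mul_one, (ht.geomRep_root_eq_iff x).2 hl]
  simp [mul_assoc]

lemma _root_.BruhatLE.length_le {x y : W} (h : BruhatLE cs x y) : cs.length x ≤ cs.length y := by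
  induction h with
  | refl => rfl
  | tail _ h ih => obtain ⟨t, _, _, hl⟩ := h; omega

lemma _root_.BruhatLE.mul_simple_or {x y : W} (h : BruhatLE cs x y) (i : B) :
    BruhatLE cs (x * cs.simple i) y ∨ BruhatLE cs (x * cs.simple i) (y * cs.simple i) := by
  induction h with
  | refl => exact .inr .refl
  | tail _ h ih =>
    rcases ih with ih | ih
    · exact .inl (ih.tail h)
    · rcases h.mul_simple_s9 i with h1 | h1
      · exact .inl (h1 ▸ ih)
      · exact .inr (ih.tail h1)

lemma _root_.BruhatLE.mul_simple_of_lt {x y : W} (h : BruhatLE cs x y) {i : B}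
    (hi : cs.length y < cs.length (y * cs.simple i)) :
    BruhatLE cs (x * cs.simple i) (y * cs.simple i) :=
  (h.mul_simple_or i).elim (fun h ↦ h.tail (bruhatEdge_mul_simple_of_lt hi)) id

lemma _root_.BruhatLE.trans_mul_simple {x y : W} (h : BruhatLE cs x y) {i : B}
    (hi : cs.length y < cs.length (y * cs.simple i)) :
    BruhatLE cs x (y * cs.simple i) :=
  h.tail (bruhatEdge_mul_simple_of_lt hi)

lemma _root_.BruhatLE.mul_left {t x y : W} (ht : cs.IsReflection t) (h : BruhatLE cs x y)
    (hl : cs.length (t * x) < cs.length x) : BruhatLE cs (t * x) y :=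
  h.head (bruhatEdge_of_mul_left ht hl)

variable (cs) in
/-- Every element is obtained from the identity by length-increasing right multiplications by
simple reflections. -/
lemma length_induction_right {P : W → Prop} (w : W) (one : P 1)
    (mul_simple_s9 : ∀ w i, cs.length w < cs.length (w * cs.simple i) → P w → P (w * cs.simple i)) :
    P w := by
  induction hn : cs.length w using Nat.strong_induction_on generalizing w with
  | _ n ih =>
  rcases eq_or_ne w 1 with rfl | hw
  · exact one
  obtain ⟨i, hi⟩ := cs.exists_rightDescent_of_ne_one hw
  have := mul_simple_s9 (w * cs.simple i) i (by simpa [IsRightDescent] using hi)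
    (ih _ (by subst hn; exact hi) _ rfl)
  simpa using this

variable (cs) in
lemma one_bruhatLE (w : W) : BruhatLE cs 1 w :=
  cs.length_induction_right w .refl fun _ _ h ih ↦ ih.trans_mul_simple h

lemma eq_one_of_bruhatLE_one {x : W} (h : BruhatLE cs x 1) : x = 1 := by
  have := h.length_le
  rw [cs.length_one] at this
  exact cs.length_eq_zero_iff.1 (by omega)

lemma _root_.BruhatLE.eq_of_length_le {x y : W} (h : BruhatLE cs x y)
    (hl : cs.length y ≤ cs.length x) : x = y := by
  rcases Relation.ReflTransGen.cases_head h with h | ⟨z, ⟨t, _, _, h1⟩, h2⟩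
  · exact h
  · have := BruhatLE.length_le h2
    omega

end Bruhat

section Finset

open scoped Classical

variable {B W : Type*} [Group W] [Fintype W] {M : CoxeterMatrix B} (cs : CoxeterSystem M W)

/-- The reflections `t` such that `t * v` lies in `V`. -/
noncomputable def reflIn (V : Set W) (v : W) : Finset W :=
  {t | cs.IsReflection t ∧ t * v ∈ V}

/-- The reflections `t` such that `t * v` does not lie in `V`. -/
noncomputable def reflOut (V : Set W) (v : W) : Finset W :=
  {t | cs.IsReflection t ∧ t * v ∉ V}

/-- The left inversions of `w`. -/
noncomputable def leftInv (w : W) : Finset W :=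
  {t | cs.IsReflection t ∧ cs.length (t * w) < cs.length w}

variable {cs}

lemma mem_reflIn {V : Set W} {v t : W} :
    t ∈ cs.reflIn V v ↔ cs.IsReflection t ∧ t * v ∈ V := by simp [reflIn]

lemma mem_reflOut {V : Set W} {v t : W} :
    t ∈ cs.reflOut V v ↔ cs.IsReflection t ∧ t * v ∉ V := by simp [reflOut]

lemma mem_leftInv {w t : W} :
    t ∈ cs.leftInv w ↔ cs.IsReflection t ∧ cs.length (t * w) < cs.length w := by simp [leftInv]

lemma degIn_eq_card_reflIn (V : Set W) (v : W) : degIn cs V v = (cs.reflIn V v).card := by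
  rw [← Nat.card_eq_finsetCard, degIn]
  refine Nat.card_congr ⟨fun y ↦ ⟨y * v⁻¹, ?_⟩, fun t ↦ ⟨t * v, ?_⟩,
    fun y ↦ by simp, fun t ↦ by simp⟩
  · obtain ⟨y, hy, h⟩ := y
    rw [mem_reflIn]
    refine ⟨?_, by simpa using hy⟩
    rcases h with h | h
    · obtain ⟨t, ht, rfl, -⟩ := bruhatEdge_iff.1 h
      simpa using ht
    · obtain ⟨t, ht, rfl, -⟩ := bruhatEdge_iff.1 h
      simpa [ht.inv] using ht
  · obtain ⟨t, h⟩ := t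
    rw [mem_reflIn] at h
    refine ⟨h.2, ?_⟩
    rcases lt_or_gt_of_ne (h.1.length_mul_right_ne v) with h1 | h1
    · exact .inr (bruhatEdge_of_mul_left h.1 h1)
    · exact .inl (bruhatEdge_mul_left h.1 h1)

lemma leftInv_one : cs.leftInv 1 = ∅ := by
  ext t
  simp [mem_leftInv]

lemma leftInv_mul_simple {w : W} {i : B} (h : cs.length w < cs.length (w * cs.simple i)) :
    cs.leftInv (w * cs.simple i) = insert (w * cs.simple i * w⁻¹) (cs.leftInv w) := by
  ext t
  rw [Finset.mem_insert, mem_leftInv, mem_leftInv]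
  by_cases ht : cs.IsReflection t
  · by_cases h1 : t * w = w * cs.simple i
    · have h2 : t = w * cs.simple i * w⁻¹ := eq_mul_inv_of_mul_eq h1
      exact iff_of_true ⟨ht, by rwa [← mul_assoc, h1, cs.simple_mul_simple_cancel_right]⟩ (.inl h2)
    · have h2 : t ≠ w * cs.simple i * w⁻¹ := fun h' ↦ h1 (eq_mul_inv_iff_mul_eq.1 h')
      simp [ht, h2, ht.length_mul_mul_simple_lt_iff h1]
  · have h2 : t ≠ w * cs.simple i * w⁻¹ := by
      rintro rfl; exact ht ((cs.isReflection_simple i).conj w)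
    simp [ht, h2]

lemma notMem_leftInv_of_lt {w : W} {i : B} (h : cs.length w < cs.length (w * cs.simple i)) :
    w * cs.simple i * w⁻¹ ∉ cs.leftInv w := by
  simp [mem_leftInv, h.le]

lemma card_leftInv (w : W) : (cs.leftInv w).card = cs.length w := by
  refine cs.length_induction_right (P := fun w ↦ (cs.leftInv w).card = cs.length w) w
    (by rw [leftInv_one]; simp) fun w i h ih ↦ ?_
  rw [leftInv_mul_simple h, Finset.card_insert_of_notMem (notMem_leftInv_of_lt h), ih]
  have := cs.length_mul_simple w i
  omega

lemma reflIn_bruhatLE_self (w : W) : cs.reflIn {v | BruhatLE cs v w} w = cs.leftInv w := by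
  ext t
  rw [mem_reflIn, mem_leftInv, and_congr_right_iff]
  intro ht
  constructor
  · intro h
    exact lt_of_le_of_ne (BruhatLE.length_le h) (ht.length_mul_right_ne w)
  · exact fun h ↦ .single (bruhatEdge_of_mul_left ht h)

end Finset

end CoxeterSystem

/-- A vector, seen as a linear form in the polynomial ring. -/
noncomputable def linearForm {B : Type*} : (B →₀ ℝ) →ₗ[ℝ] MvPolynomial B ℝ :=
  Finsupp.linearCombination ℝ MvPolynomial.X

section LinearForm

variable {B : Type*}

lemma linearForm_injective : Function.Injective (linearForm (B := B)) :=
  MvPolynomial.linearIndependent_X B ℝ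

lemma linearForm_ne_zero {x : B →₀ ℝ} (hx : x ≠ 0) : linearForm x ≠ 0 := by
  rwa [Ne, map_eq_zero_iff _ linearForm_injective]

lemma totalDegree_linearForm {x : B →₀ ℝ} (hx : x ≠ 0) : (linearForm x).totalDegree = 1 := by
  refine MvPolynomial.IsHomogeneous.totalDegree ?_ (linearForm_ne_zero hx)
  rw [linearForm, Finsupp.linearCombination_apply]
  refine MvPolynomial.IsHomogeneous.sum _ _ _ fun i _ ↦ ?_
  exact (MvPolynomial.homogeneousSubmodule B ℝ 1).smul_mem _ (MvPolynomial.isHomogeneous_X ℝ i)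

lemma prime_linearForm {x : B →₀ ℝ} (hx : x ≠ 0) : Prime (linearForm x) := by
  refine (MvPolynomial.irreducible_of_totalDegree_eq_one (totalDegree_linearForm hx)
    fun c hc ↦ ?_).prime
  rw [isUnit_iff_ne_zero]
  rintro rfl
  apply linearForm_ne_zero hx
  ext i
  simpa using hc i

lemma exists_eq_smul_of_linearForm_dvd {x y : B →₀ ℝ} (hx : x ≠ 0)
    (h : linearForm x ∣ linearForm y) : ∃ c : ℝ, y = c • x := by
  rcases eq_or_ne y 0 with rfl | hy
  · exact ⟨0, by simp⟩
  obtain ⟨q, hq⟩ := h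
  have hq0 : q ≠ 0 := by
    rintro rfl
    exact linearForm_ne_zero hy (by simpa using hq)
  have hd := MvPolynomial.totalDegree_mul_of_isDomain (linearForm_ne_zero hx) hq0
  rw [← hq, totalDegree_linearForm hx, totalDegree_linearForm hy] at hd
  have hC := MvPolynomial.totalDegree_eq_zero_iff_eq_C.1 (show q.totalDegree = 0 by omega)
  refine ⟨MvPolynomial.coeff 0 q, linearForm_injective ?_⟩
  rw [hq, map_smul, MvPolynomial.smul_eq_C_mul, ← hC, mul_comm]

end LinearForm

namespace CoxeterSystem

variable {B W : Type*} [Group W] {M : CoxeterMatrix B} (cs : CoxeterSystem M W)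

/-- The Goresky–Kottwitz–MacPherson congruences on a set `V`. -/
def IsCongruent (V : Set W) (z : W → MvPolynomial B ℝ) : Prop :=
  ∀ v t, cs.IsReflection t → v ∈ V → t * v ∈ V → linearForm (cs.root t) ∣ z v - z (t * v)

variable {cs}

lemma IsReflection.not_linearForm_dvd {t r : W} (ht : cs.IsReflection t) (hr : cs.IsReflection r)
    (h : t ≠ r) : ¬ linearForm (cs.root t) ∣ linearForm (cs.root r) := by
  intro hd
  obtain ⟨c, hc⟩ := exists_eq_smul_of_linearForm_dvd ht.root_ne_zero hd
  exact h (hr.eq_of_root_eq_smul ht hc).symm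

lemma geomRep_single_eq_or (v : W) (i : B) :
    cs.geomRep v (Finsupp.single i 1) = cs.root (v * cs.simple i * v⁻¹) ∨
      cs.geomRep v (Finsupp.single i 1) = -cs.root (v * cs.simple i * v⁻¹) := by
  simpa [root_simple] using (cs.isReflection_simple i).geomRep_root_or v

lemma linearForm_root_dvd_iff {v : W} {i : B} {p : MvPolynomial B ℝ} :
    linearForm (cs.root (v * cs.simple i * v⁻¹)) ∣ p ↔
      linearForm (cs.geomRep v (Finsupp.single i 1)) ∣ p := by
  rcases cs.geomRep_single_eq_or v i with h | h <;> simp [h]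

lemma geomRep_single_ne_zero (v : W) (i : B) : cs.geomRep v (Finsupp.single i 1) ≠ 0 := by
  simp

/-- Divided differences preserve the congruences. -/
lemma IsCongruent.exists_dividedDifference {w : W} {i : B}
    (hw : cs.length w < cs.length (w * cs.simple i)) {z : W → MvPolynomial B ℝ}
    (hz : cs.IsCongruent {v | BruhatLE cs v (w * cs.simple i)} z) :
    ∃ D : W → MvPolynomial B ℝ, cs.IsCongruent {v | BruhatLE cs v w} D ∧
      ∀ v, BruhatLE cs v w → linearForm (cs.geomRep v (Finsupp.single i 1)) * D v =
        z v - z (v * cs.simple i) := by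
  have h1 : ∀ v, ∃ d, BruhatLE cs v w →
      linearForm (cs.geomRep v (Finsupp.single i 1)) * d = z v - z (v * cs.simple i) := by
    intro v
    by_cases hv : BruhatLE cs v w
    · have := hz v (v * cs.simple i * v⁻¹) ((cs.isReflection_simple i).conj v)
        (hv.trans_mul_simple hw) (by simpa using hv.mul_simple_of_lt hw)
      rw [linearForm_root_dvd_iff] at this
      obtain ⟨d, hd⟩ := this
      exact ⟨d, fun _ ↦ by simpa using hd.symm⟩
    · exact ⟨0, fun h ↦ (hv h).elim⟩
  choose D hD using h1
  refine ⟨D, fun v t ht hv htv ↦ ?_, hD⟩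
  have e1 := hD v hv
  have e2 := hD (t * v) htv
  by_cases h : t = v * cs.simple i * v⁻¹
  · have h2 : t * v = v * cs.simple i := by simp [h]
    rw [h2, geomRep_mul_simple_single, cs.simple_mul_simple_cancel_right, map_neg] at e2
    have : linearForm (cs.geomRep v (Finsupp.single i 1)) * (D v - D (v * cs.simple i)) = 0 := by
      linear_combination e1 + e2
    rw [mul_eq_zero, or_iff_right (linearForm_ne_zero (geomRep_single_ne_zero v i))] at this
    rw [h2, this]
    exact dvd_zero _
  · have hp := prime_linearForm ht.root_ne_zero
    have hnd : ¬ linearForm (cs.root t) ∣ linearForm (cs.geomRep v (Finsupp.single i 1)) := by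
      have := ht.not_linearForm_dvd ((cs.isReflection_simple i).conj v) h
      rcases cs.geomRep_single_eq_or v i with h | h <;> simpa [h] using this
    refine (hp.dvd_or_dvd ?_).resolve_left hnd
    have e3 : linearForm (cs.geomRep v (Finsupp.single i 1)) * (D v - D (t * v)) =
        (z v - z (t * v)) - (z (v * cs.simple i) - z (t * (v * cs.simple i))) -
        (linearForm (cs.geomRep v (Finsupp.single i 1)) -
          linearForm (cs.geomRep (t * v) (Finsupp.single i 1))) * D (t * v) := by
      rw [mul_assoc] at e2
      rw [mul_sub, e1]
      linear_combination -e2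
    rw [e3]
    refine dvd_sub (dvd_sub (hz _ _ ht (hv.trans_mul_simple hw) (htv.trans_mul_simple hw))
      (hz _ _ ht (hv.mul_simple_of_lt hw) ?_)) (Dvd.dvd.mul_right ?_ _)
    · have := BruhatLE.mul_simple_of_lt htv hw
      rwa [mul_assoc] at this
    · rw [map_mul, LinearEquiv.mul_apply, ht.geomRep_apply, map_sub, map_smul, sub_sub_cancel,
        MvPolynomial.smul_eq_C_mul]
      exact dvd_mul_left _ _

open scoped Classical in
variable (cs) in
/-- Integration over a Schubert variety by localization: a functional on congruent families which
lowers degrees by the length. -/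
theorem exists_localization [Fintype W] (w : W) :
    ∃ c : W → FractionRing (MvPolynomial B ℝ),
      (∀ v, ¬ BruhatLE cs v w → c v = 0) ∧
      (∀ z, cs.IsCongruent {v | BruhatLE cs v w} z →
        ∃ p : MvPolynomial B ℝ, algebraMap _ _ p = ∑ v, c v * algebraMap _ _ (z v) ∧
          ∀ n, (∀ v, BruhatLE cs v w → (z v).totalDegree ≤ n) → p ≠ 0 →
            p.totalDegree + cs.length w ≤ n) ∧
      (c w * algebraMap _ _ (∏ t ∈ cs.leftInv w, linearForm (cs.root t)) = 1 ∨
        c w * algebraMap _ _ (∏ t ∈ cs.leftInv w, linearForm (cs.root t)) = -1) := by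
  refine cs.length_induction_right (P := fun w ↦ ∃ c : W → FractionRing (MvPolynomial B ℝ),
      (∀ v, ¬ BruhatLE cs v w → c v = 0) ∧
      (∀ z, cs.IsCongruent {v | BruhatLE cs v w} z →
        ∃ p : MvPolynomial B ℝ, algebraMap _ _ p = ∑ v, c v * algebraMap _ _ (z v) ∧
          ∀ n, (∀ v, BruhatLE cs v w → (z v).totalDegree ≤ n) → p ≠ 0 →
            p.totalDegree + cs.length w ≤ n) ∧
      (c w * algebraMap _ _ (∏ t ∈ cs.leftInv w, linearForm (cs.root t)) = 1 ∨
        c w * algebraMap _ _ (∏ t ∈ cs.leftInv w, linearForm (cs.root t)) = -1)) w ?_ ?_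
  · refine ⟨fun v ↦ if v = 1 then 1 else 0, fun v hv ↦ if_neg ?_, fun z hz ↦ ⟨z 1, ?_, ?_⟩, ?_⟩
    · rintro rfl
      exact hv .refl
    · simp
    · intro n hn _
      simpa using hn 1 .refl
    · simp [leftInv_one]
  · rintro w i hw ⟨c, hc0, hc, hcw⟩
    let L : W → FractionRing (MvPolynomial B ℝ) :=
      fun v ↦ algebraMap _ _ (linearForm (cs.geomRep v (Finsupp.single i 1)))
    have hL0 : ∀ v, L v ≠ 0 := fun v ↦ by
      simpa [L] using linearForm_ne_zero (geomRep_single_ne_zero v i)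
    have hLs : ∀ v, L (v * cs.simple i) = - L v := fun v ↦ by
      simp only [L, geomRep_mul_simple_single, map_neg]
    have hlen : cs.length (w * cs.simple i) = cs.length w + 1 := by
      have := cs.length_mul_simple w i
      omega
    refine ⟨fun v ↦ (c v + c (v * cs.simple i)) / L v, fun v hv ↦ ?_, fun z hz ↦ ?_, ?_⟩
    · beta_reduce
      rw [hc0 v, hc0 (v * cs.simple i)]
      · simp
      · exact fun h ↦ hv (by simpa using h.mul_simple_of_lt hw)
      · exact fun h ↦ hv (h.trans_mul_simple hw)
    · obtain ⟨D, hD, hDz⟩ := hz.exists_dividedDifference hw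
      obtain ⟨p, hp, hpd⟩ := hc D hD
      have hcD : ∀ v, c v * algebraMap _ _ (D v) = c v * algebraMap _ _ (z v) / L v -
          c v * algebraMap _ _ (z (v * cs.simple i)) / L v := by
        intro v
        by_cases hv : BruhatLE cs v w
        · rw [← sub_div, ← mul_sub, ← map_sub, ← hDz v hv, map_mul, eq_div_iff (hL0 v)]
          simp only [L]
          ring
        · simp [hc0 v hv]
      refine ⟨p, ?_, fun n hn hp0 ↦ ?_⟩
      · rw [hp]
        have e : ∑ v, c v * algebraMap _ _ (z (v * cs.simple i)) / L v =
            -∑ v, c (v * cs.simple i) * algebraMap _ _ (z v) / L v := by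
          rw [← Finset.sum_neg_distrib, ← Equiv.sum_comp (Equiv.mulRight (cs.simple i))]
          refine Finset.sum_congr rfl fun v _ ↦ ?_
          simp [hLs, div_neg]
        simp_rw [hcD, Finset.sum_sub_distrib, e, sub_neg_eq_add, ← Finset.sum_add_distrib]
        exact Finset.sum_congr rfl fun v _ ↦ by ring
      · have hdeg : ∀ v, BruhatLE cs v w → D v ≠ 0 → (D v).totalDegree + 1 ≤ n := by
          intro v hv hv0
          have h1 := MvPolynomial.totalDegree_mul_of_isDomain
            (linearForm_ne_zero (cs.geomRep_single_ne_zero v i)) hv0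
          rw [totalDegree_linearForm (cs.geomRep_single_ne_zero v i), hDz v hv] at h1
          have h2 := MvPolynomial.totalDegree_sub (z v) (z (v * cs.simple i))
          have h3 := hn v (hv.trans_mul_simple hw)
          have h4 := hn _ (hv.mul_simple_of_lt hw)
          have := h2.trans (max_le h3 h4)
          omega
        have hn1 : 1 ≤ n := by
          by_contra! hn0
          apply hp0
          apply IsFractionRing.injective (MvPolynomial B ℝ) (FractionRing (MvPolynomial B ℝ))
          rw [hp, map_zero]
          refine Finset.sum_eq_zero fun v _ ↦ ?_
          by_cases hv : BruhatLE cs v w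
          · by_cases hv0 : D v = 0
            · simp [hv0]
            · have := hdeg v hv hv0
              omega
          · simp [hc0 v hv]
        have := hpd (n - 1) (fun v hv ↦ ?_) hp0
        · omega
        · by_cases hv0 : D v = 0
          · simp [hv0]
          · have := hdeg v hv hv0
            omega
    · have h1 : c (w * cs.simple i) = 0 := hc0 _ fun h ↦ by
        have := h.length_le
        omega
      have h2 := hL0 w
      rw [leftInv_mul_simple hw, Finset.prod_insert (notMem_leftInv_of_lt hw)]
      beta_reduce
      rw [hLs, cs.simple_mul_simple_cancel_right, h1, zero_add, map_mul]
      set P := algebraMap (MvPolynomial B ℝ) (FractionRing (MvPolynomial B ℝ))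
        (∏ t ∈ cs.leftInv w, linearForm (cs.root t))
      rcases cs.geomRep_single_eq_or w i with h | h
      · rw [← h]
        have : c w / -L w * (L w * P) = -(c w * P) := by field_simp
        rw [show algebraMap (MvPolynomial B ℝ) (FractionRing (MvPolynomial B ℝ))
          (linearForm (cs.geomRep w (Finsupp.single i 1))) = L w from rfl, this, neg_inj,
          neg_eq_iff_eq_neg]
        exact hcw.symm
      · rw [← neg_eq_iff_eq_neg.2 h, map_neg, map_neg]
        have : c w / -L w * (-L w * P) = c w * P := by field_simp
        rw [show algebraMap (MvPolynomial B ℝ) (FractionRing (MvPolynomial B ℝ))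
          (linearForm (cs.geomRep w (Finsupp.single i 1))) = L w from rfl, this]
        exact hcw

end CoxeterSystem

namespace CoxeterSystem

section

variable {B W : Type*} [Group W] {M : CoxeterMatrix B} {cs : CoxeterSystem M W}

lemma totalDegree_prod_root_le {A : Finset W} :
    (∏ r ∈ A, linearForm (cs.root r)).totalDegree ≤ A.card := by
  refine (MvPolynomial.totalDegree_finsetProd _ _).trans ?_
  rw [Finset.card_eq_sum_ones]
  refine Finset.sum_le_sum fun r _ ↦ ?_
  rcases eq_or_ne (cs.root r) 0 with h | h
  · simp [h]
  · rw [totalDegree_linearForm h]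

lemma IsReflection.eq_zero_of_dvd_C_mul_prod {t : W} (ht : cs.IsReflection t) {A : Finset W}
    (hA : ∀ r ∈ A, cs.IsReflection r) (htA : t ∉ A) {k : ℝ}
    (h : linearForm (cs.root t) ∣ MvPolynomial.C k * ∏ r ∈ A, linearForm (cs.root r)) : k = 0 := by
  have hp := prime_linearForm ht.root_ne_zero
  rcases hp.dvd_or_dvd h with h | h
  · by_contra hk
    exact hp.not_isUnit (isUnit_of_dvd_unit h ((isUnit_iff_ne_zero.2 hk).map MvPolynomial.C))
  · obtain ⟨r, hr, h⟩ := (hp.dvd_finsetProd_iff _).1 h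
    exact (ht.not_linearForm_dvd (hA r hr) (fun h ↦ htA (h ▸ hr)) h).elim

end

open scoped Classical

variable {B W : Type*} [Group W] [Fintype W] {M : CoxeterMatrix B} {cs : CoxeterSystem M W}

lemma isCongruent_single {V : Set W} {v : W} :
    cs.IsCongruent V
      (fun x ↦ if x = v then ∏ r ∈ cs.reflIn V v, linearForm (cs.root r) else 0) := by
  intro x r hr hx hrx
  rcases eq_or_ne x v with rfl | hxv
  · have : r * x ≠ x := fun h ↦ hr.length_mul_right_ne x (by rw [h])
    simp only [if_true, this, if_false, sub_zero]
    exact Finset.dvd_prod_of_mem _ (mem_reflIn.2 ⟨hr, hrx⟩)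
  · rcases eq_or_ne (r * x) v with h | h
    · simp only [hxv, h, if_true, if_false, zero_sub, dvd_neg]
      refine Finset.dvd_prod_of_mem _ (mem_reflIn.2 ⟨hr, ?_⟩)
      rw [← h, ← mul_assoc, hr.mul_self, one_mul]
      exact hx
    · simp [hxv, h]

lemma isCongruent_pair {V : Set W} {v t : W} (ht : cs.IsReflection t) :
    cs.IsCongruent V
      (fun x ↦ if x = v ∨ x = t * v then
        (∏ r ∈ (cs.reflIn V v).erase t, linearForm (cs.root r)) *
          ∏ r ∈ (cs.reflIn V (t * v)).erase t, linearForm (cs.root r) else 0) := by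
  have key : ∀ x r, cs.IsReflection r → r * x ∈ V → (x = v ∨ x = t * v) →
      ¬ (r * x = v ∨ r * x = t * v) → linearForm (cs.root r) ∣
      (∏ r ∈ (cs.reflIn V v).erase t, linearForm (cs.root r)) *
          ∏ r ∈ (cs.reflIn V (t * v)).erase t, linearForm (cs.root r) := by
    intro x r hr hrx hx h
    rcases hx with rfl | rfl
    · refine dvd_mul_of_dvd_left
          (Finset.dvd_prod_of_mem (fun r ↦ linearForm (cs.root r)) (Finset.mem_erase.2 ⟨?_, ?_⟩)) _
      · rintro rfl
        exact h (.inr rfl)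
      · exact mem_reflIn.2 ⟨hr, hrx⟩
    · refine dvd_mul_of_dvd_right
          (Finset.dvd_prod_of_mem (fun r ↦ linearForm (cs.root r)) (Finset.mem_erase.2 ⟨?_, ?_⟩)) _
      · rintro rfl
        exact h (.inl (by rw [← mul_assoc, hr.mul_self, one_mul]))
      · exact mem_reflIn.2 ⟨hr, hrx⟩
  intro x r hr hx hrx
  by_cases h1 : x = v ∨ x = t * v <;> by_cases h2 : r * x = v ∨ r * x = t * v
  · simp only [h1, h2, if_true, sub_self, dvd_zero]
  · simp only [h1, h2, if_true, if_false, sub_zero]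
    exact key x r hr hrx h1 h2
  · simp only [h1, h2, if_true, if_false, zero_sub, dvd_neg]
    have h3 : r * (r * x) = x := by rw [← mul_assoc, hr.mul_self, one_mul]
    exact key (r * x) r hr (by rwa [h3]) h2 (by rwa [h3])
  · simp only [h1, h2, if_false, sub_zero, dvd_zero]

/-- If the Bruhat graph below `w` is regular, the products of the roots of the edges at two
adjacent vertices satisfy a linear congruence. -/
theorem exists_edge_congruence {w : W}
    (hreg : ∀ v, BruhatLE cs v w → (cs.reflIn {v | BruhatLE cs v w} v).card = cs.length w) :
    ∃ κ : W → ℝ, (∀ v, BruhatLE cs v w → κ v ≠ 0) ∧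
      ∀ v t, cs.IsReflection t → BruhatLE cs v w → BruhatLE cs (t * v) w →
        linearForm (cs.root t) ∣
          MvPolynomial.C (κ v) *
            ∏ r ∈ (cs.reflIn {v | BruhatLE cs v w} (t * v)).erase t, linearForm (cs.root r) +
          MvPolynomial.C (κ (t * v)) *
            ∏ r ∈ (cs.reflIn {v | BruhatLE cs v w} v).erase t, linearForm (cs.root r) := by
  obtain ⟨c, hc0, hc, hcw⟩ := cs.exists_localization w
  set V := {v | BruhatLE cs v w} with hV
  have hk : ∀ v, ∃ k : ℝ, BruhatLE cs v w →
      c v * algebraMap _ _ (∏ r ∈ cs.reflIn V v, linearForm (cs.root r)) =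
        algebraMap (MvPolynomial B ℝ) _ (MvPolynomial.C k) := by
    intro v
    by_cases hv : BruhatLE cs v w
    · obtain ⟨p, hp, hpd⟩ := hc _ (isCongruent_single (v := v))
      have hp0 : p.totalDegree = 0 := by
        by_contra hne
        have := hpd (cs.length w) (fun x _ ↦ ?_) (fun h ↦ hne (by simp [h]))
        · omega
        · split_ifs
          · rw [← hreg v hv]
            exact totalDegree_prod_root_le
          · simp
      refine ⟨MvPolynomial.coeff 0 p, fun _ ↦ ?_⟩
      rw [← MvPolynomial.totalDegree_eq_zero_iff_eq_C.1 hp0, hp, Finset.sum_eq_single v]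
      · simp
      · intro x _ hx
        simp [hx]
      · simp
    · exact ⟨0, fun h ↦ (hv h).elim⟩
  choose κ hκ using hk
  have hedge : ∀ v t, cs.IsReflection t → BruhatLE cs v w → BruhatLE cs (t * v) w →
      linearForm (cs.root t) ∣
        MvPolynomial.C (κ v) * ∏ r ∈ (cs.reflIn V (t * v)).erase t, linearForm (cs.root r) +
        MvPolynomial.C (κ (t * v)) * ∏ r ∈ (cs.reflIn V v).erase t, linearForm (cs.root r) := by
    intro v t ht hv htv
    obtain ⟨p, hp, -⟩ := hc _ (isCongruent_pair (v := v) ht)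
    refine ⟨p, IsFractionRing.injective (MvPolynomial B ℝ) (FractionRing (MvPolynomial B ℝ)) ?_⟩
    have hne : v ≠ t * v := fun h ↦ ht.length_mul_right_ne v (by rw [← h])
    have ht1 : t ∈ cs.reflIn V v := mem_reflIn.2 ⟨ht, htv⟩
    have ht2 : t ∈ cs.reflIn V (t * v) := by
      refine mem_reflIn.2 ⟨ht, ?_⟩
      rwa [← mul_assoc, ht.mul_self, one_mul]
    rw [map_add, map_mul, map_mul, map_mul, ← hκ v hv, ← hκ _ htv, hp,
      ← Finset.mul_prod_erase _ _ ht1, ← Finset.mul_prod_erase _ _ ht2,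
      ← Finset.sum_subset (Finset.subset_univ {v, t * v}), Finset.sum_pair hne]
    · simp only [true_or, or_true, if_true, map_mul]
      ring
    · intro x _ hx
      have : ¬ (x = v ∨ x = t * v) := by simpa using hx
      simp [this]
  refine ⟨κ, fun v hv ↦ ?_, hedge⟩
  induction hv using Relation.ReflTransGen.head_induction_on with
  | refl =>
    intro h0
    have := hκ w .refl
    rw [reflIn_bruhatLE_self, h0] at this
    rw [this] at hcw
    simp at hcw
  | head hxy hyw ih =>
    rename_i x y
    intro h0
    apply ih
    obtain ⟨t, ht, rfl, -⟩ := bruhatEdge_iff.1 hxy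
    have := hedge x t ht (.head hxy hyw) hyw
    rw [h0, map_zero, zero_mul, zero_add] at this
    exact ht.eq_zero_of_dvd_C_mul_prod
      (fun r hr ↦ (mem_reflIn.1 (Finset.mem_of_mem_erase hr)).1) (Finset.notMem_erase _ _) this

end CoxeterSystem

lemma aeval_linearForm {B : Type*} (p d : Module.Dual ℝ (B →₀ ℝ)) (x : B →₀ ℝ) :
    MvPolynomial.aeval (fun i ↦ C (p (Finsupp.single i 1)) + C (d (Finsupp.single i 1)) * X)
      (linearForm x) = C (p x) + C (d x) * X := by
  induction x using Finsupp.induction_linear with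
  | zero => simp
  | add x y hx hy => simp only [map_add, hx, hy]; ring
  | single i a =>
    have : Finsupp.single i a = a • Finsupp.single i (1 : ℝ) := by simp
    rw [this, map_smul, map_smul, map_smul p, map_smul d, smul_eq_mul, smul_eq_mul, map_mul,
      map_mul]
    have h1 : linearForm (Finsupp.single i 1) = MvPolynomial.X i := by simp [linearForm]
    rw [h1, MvPolynomial.aeval_X, smul_eq_C_mul]
    ring

namespace CoxeterSystem

section Plane

variable {B W : Type*} [Group W] {M : CoxeterMatrix B} (cs : CoxeterSystem M W)

/-- The span of the roots of two reflections. -/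
noncomputable def plane (t r : W) : Submodule ℝ (B →₀ ℝ) :=
  Submodule.span ℝ {cs.root t, cs.root r}

variable {cs}

lemma mem_plane {t r : W} {x : B →₀ ℝ} :
    x ∈ cs.plane t r ↔ ∃ a b : ℝ, a • cs.root t + b • cs.root r = x :=
  Submodule.mem_span_pair

variable (cs) in
lemma root_mem_plane_left (t r : W) : cs.root t ∈ cs.plane t r :=
  Submodule.subset_span (by simp)

variable (cs) in
lemma root_mem_plane_right (t r : W) : cs.root r ∈ cs.plane t r :=
  Submodule.subset_span (by simp)

lemma IsReflection.root_notMem_span {t r : W} (ht : cs.IsReflection t) (hr : cs.IsReflection r)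
    (h : r ≠ t) : cs.root r ∉ Submodule.span ℝ {cs.root t} := by
  rw [Submodule.mem_span_singleton]
  rintro ⟨a, ha⟩
  exact h (hr.eq_of_root_eq_smul ht ha.symm)

lemma IsReflection.plane_eq_iff {t r r' : W} (ht : cs.IsReflection t) (hr : cs.IsReflection r)
    (hrt : r' ≠ t) (hr' : cs.IsReflection r') :
    cs.plane t r = cs.plane t r' ↔ r ≠ t ∧ cs.root r ∈ cs.plane t r' := by
  constructor
  · intro h
    refine ⟨?_, h ▸ cs.root_mem_plane_right t r⟩
    rintro rfl
    have := cs.root_mem_plane_right r r'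
    rw [← h, plane, Set.pair_eq_singleton] at this
    exact hr.root_notMem_span hr' hrt this
  · rintro ⟨h, h1⟩
    apply le_antisymm
    · rw [plane, Submodule.span_le]
      rintro x (rfl | rfl)
      · exact cs.root_mem_plane_left t r'
      · exact h1
    · rw [plane, Submodule.span_le]
      rintro x (rfl | rfl)
      · exact cs.root_mem_plane_left t r
      · obtain ⟨a, b, hab⟩ := mem_plane.1 h1
        have hb : b ≠ 0 := by
          rintro rfl
          exact h (hr.eq_of_root_eq_smul ht (c := a) (by rw [← hab]; simp))
        refine mem_plane.2 ⟨-(b⁻¹ * a), b⁻¹, ?_⟩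
        rw [← hab, smul_add, smul_smul, smul_smul, inv_mul_cancel₀ hb]
        module

end Plane

open scoped Classical

variable {B W : Type*} [Group W] [Fintype W] {M : CoxeterMatrix B} {cs : CoxeterSystem M W}

lemma IsReflection.exists_dual_plane {t r₀ : W} (ht : cs.IsReflection t) (hr₀ : cs.IsReflection r₀)
    (h : r₀ ≠ t) :
    ∃ p d : Module.Dual ℝ (B →₀ ℝ), p (cs.root t) = 0 ∧ d (cs.root t) = 0 ∧
      ∀ r, cs.IsReflection r → r ≠ t →
        (cs.plane t r ≠ cs.plane t r₀ → p (cs.root r) ≠ 0) ∧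
        (cs.plane t r = cs.plane t r₀ → p (cs.root r) = 0 ∧ d (cs.root r) ≠ 0) := by
  obtain ⟨d, hd, hdt⟩ := Submodule.exists_dual_map_eq_bot_of_notMem
    (ht.root_notMem_span hr₀ h) inferInstance
  have hdt : d (cs.root t) = 0 := by
    rw [Submodule.map_span, Set.image_singleton, Submodule.span_singleton_eq_bot] at hdt
    exact hdt
  obtain ⟨f, hf⟩ := Module.exists_dual_forall_apply_ne_zero (K := ℝ)
    (fun r : {r : W // cs.root r ∉ cs.plane t r₀} ↦ (cs.plane t r₀).mkQ (cs.root r))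
    (fun r ↦ by simpa using r.2)
  have hp : ∀ x ∈ cs.plane t r₀, f ((cs.plane t r₀).mkQ x) = 0 := by
    intro x hx
    rw [Submodule.mkQ_apply, (Submodule.Quotient.mk_eq_zero _).2 hx, map_zero]
  refine ⟨f.comp (cs.plane t r₀).mkQ, d, hp _ (cs.root_mem_plane_left _ _), hdt,
    fun r hr hrt ↦ ⟨fun hne ↦ ?_, fun he ↦ ⟨?_, ?_⟩⟩⟩
  · refine hf ⟨r, fun hmem ↦ hne ?_⟩
    exact (ht.plane_eq_iff hr h hr₀).2 ⟨hrt, hmem⟩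
  · exact hp _ (he ▸ cs.root_mem_plane_right t r)
  · obtain ⟨a, b, hab⟩ := mem_plane.1 (he ▸ cs.root_mem_plane_right t r)
    rw [← hab, map_add, map_smul, map_smul, hdt, smul_zero, zero_add, smul_eq_mul]
    refine mul_ne_zero ?_ hd
    rintro rfl
    exact hrt (hr.eq_of_root_eq_smul ht (c := a) (by rw [← hab]; simp))

lemma IsReflection.card_plane_eq_of_dvd {t r₀ : W} (ht : cs.IsReflection t)
    (hr₀ : cs.IsReflection r₀) (h : r₀ ≠ t) {A A' : Finset W} (hA : ∀ r ∈ A, cs.IsReflection r)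
    (hA' : ∀ r ∈ A', cs.IsReflection r) (htA : t ∉ A) (htA' : t ∉ A') {k k' : ℝ} (hk : k ≠ 0)
    (hk' : k' ≠ 0)
    (hdvd : linearForm (cs.root t) ∣ MvPolynomial.C k * ∏ r ∈ A, linearForm (cs.root r) +
      MvPolynomial.C k' * ∏ r ∈ A', linearForm (cs.root r)) :
    (A.filter fun r ↦ cs.plane t r = cs.plane t r₀).card =
      (A'.filter fun r ↦ cs.plane t r = cs.plane t r₀).card := by
  obtain ⟨p, d, hpt, hdt, hpd⟩ := ht.exists_dual_plane hr₀ h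
  let φ : MvPolynomial B ℝ →ₐ[ℝ] ℝ[X] :=
    MvPolynomial.aeval (fun i ↦ C (p (Finsupp.single i 1)) + C (d (Finsupp.single i 1)) * X)
  have hφ : ∀ x, φ (linearForm x) = C (p x) + C (d x) * X := aeval_linearForm p d
  have key : ∀ A : Finset W, (∀ r ∈ A, cs.IsReflection r) → t ∉ A →
      φ (∏ r ∈ A, linearForm (cs.root r)) ≠ 0 ∧
      (φ (∏ r ∈ A, linearForm (cs.root r))).natTrailingDegree =
        (A.filter fun r ↦ cs.plane t r = cs.plane t r₀).card := by
    intro A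
    induction A using Finset.induction_on with
    | empty => simp
    | insert r A hr ih =>
      intro hA htA
      rw [Finset.mem_insert, not_or] at htA
      obtain ⟨ih1, ih2⟩ := ih (fun r hr ↦ hA r (Finset.mem_insert_of_mem hr)) htA.2
      have hrr := hpd r (hA r (Finset.mem_insert_self r A)) (Ne.symm htA.1)
      rw [Finset.prod_insert hr, map_mul, hφ, Finset.filter_insert]
      have h1 : C (p (cs.root r)) + C (d (cs.root r)) * X ≠ (0 : ℝ[X]) ∧
          (C (p (cs.root r)) + C (d (cs.root r)) * X : ℝ[X]).natTrailingDegree =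
            if cs.plane t r = cs.plane t r₀ then 1 else 0 := by
        split_ifs with he
        · obtain ⟨h1, h2⟩ := hrr.2 he
          rw [h1, map_zero, zero_add]
          refine ⟨by simpa using h2, ?_⟩
          rw [natTrailingDegree_mul (by simpa using h2) X_ne_zero]
          simp
        · have h2 : (C (p (cs.root r)) + C (d (cs.root r)) * X : ℝ[X]).coeff 0 ≠ 0 := by
            simpa using hrr.1 he
          exact ⟨fun h0 ↦ h2 (by rw [h0, coeff_zero]),
            natTrailingDegree_eq_zero.2 (.inr h2)⟩
      refine ⟨mul_ne_zero h1.1 ih1, ?_⟩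
      rw [natTrailingDegree_mul h1.1 ih1, h1.2, ih2]
      split_ifs with he
      · rw [Finset.card_insert_of_notMem (fun hm ↦ hr (Finset.mem_of_mem_filter _ hm)), add_comm]
      · rw [zero_add]
  obtain ⟨q, hq⟩ := hdvd
  have h1 := congrArg φ hq
  rw [map_mul, hφ, hpt, hdt, map_add, map_mul, map_mul, MvPolynomial.algHom_C,
    MvPolynomial.algHom_C, map_zero, zero_mul, add_zero, zero_mul, ← eq_neg_iff_add_eq_zero] at h1
  have h2 := congrArg natTrailingDegree h1
  obtain ⟨k1, k2⟩ := key A hA htA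
  obtain ⟨k1', k2'⟩ := key A' hA' htA'
  rw [← neg_mul, ← map_neg, algebraMap_eq, natTrailingDegree_mul (by simpa using hk) k1,
    natTrailingDegree_mul (by simpa using hk') k1', k2, k2'] at h2
  simpa using h2

/-- In a regular lower interval, the numbers of edges at two adjacent vertices agree in every
plane containing the root of the edge. -/
theorem card_reflIn_plane_eq {w : W}
    (hreg : ∀ v, BruhatLE cs v w → (cs.reflIn {v | BruhatLE cs v w} v).card = cs.length w)
    {v t r₀ : W} (ht : cs.IsReflection t) (hr₀ : cs.IsReflection r₀) (h : r₀ ≠ t)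
    (hv : BruhatLE cs v w) (htv : BruhatLE cs (t * v) w) :
    ((cs.reflIn {v | BruhatLE cs v w} v).filter fun r ↦ cs.plane t r = cs.plane t r₀).card =
      ((cs.reflIn {v | BruhatLE cs v w} (t * v)).filter
        fun r ↦ cs.plane t r = cs.plane t r₀).card := by
  obtain ⟨κ, hκ, hdvd⟩ := exists_edge_congruence hreg
  have hm : ∀ x r, r ∈ (cs.reflIn {v | BruhatLE cs v w} x).erase t → cs.IsReflection r :=
    fun x r hr ↦ (mem_reflIn.1 (Finset.mem_of_mem_erase hr)).1
  have := ht.card_plane_eq_of_dvd hr₀ h (hm _) (hm _) (Finset.notMem_erase _ _)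
    (Finset.notMem_erase _ _) (hκ _ hv) (hκ _ htv) (hdvd v t ht hv htv)
  have ht' : cs.plane t t ≠ cs.plane t r₀ := fun he ↦
    ((ht.plane_eq_iff ht h hr₀).1 he).1 rfl
  rw [Finset.filter_erase, Finset.filter_erase, Finset.erase_eq_of_notMem (by simp [ht']),
    Finset.erase_eq_of_notMem (by simp [ht'])] at this
  exact this.symm

lemma card_reflOut_plane_eq {w : W}
    (hreg : ∀ v, BruhatLE cs v w → (cs.reflIn {v | BruhatLE cs v w} v).card = cs.length w)
    {v t r₀ : W} (ht : cs.IsReflection t) (hr₀ : cs.IsReflection r₀) (h : r₀ ≠ t)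
    (hv : BruhatLE cs v w) (htv : BruhatLE cs (t * v) w) :
    ((cs.reflOut {v | BruhatLE cs v w} v).filter fun r ↦ cs.plane t r = cs.plane t r₀).card =
      ((cs.reflOut {v | BruhatLE cs v w} (t * v)).filter
        fun r ↦ cs.plane t r = cs.plane t r₀).card := by
  have key : ∀ x, ((cs.reflIn {v | BruhatLE cs v w} x).filter
      fun r ↦ cs.plane t r = cs.plane t r₀).card + ((cs.reflOut {v | BruhatLE cs v w} x).filter
      fun r ↦ cs.plane t r = cs.plane t r₀).card =
      (Finset.univ.filter fun r ↦ cs.IsReflection r ∧ cs.plane t r = cs.plane t r₀).card := by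
    intro x
    rw [← Finset.card_union_of_disjoint]
    · congr 1
      ext r
      simp only [Finset.mem_union, Finset.mem_filter, mem_reflIn, mem_reflOut, Finset.mem_univ]
      tauto
    · rw [Finset.disjoint_left]
      intro r h1 h2
      simp only [Finset.mem_filter, mem_reflIn, mem_reflOut] at h1 h2
      tauto
  have h1 := key v
  have h2 := key (t * v)
  have h3 := card_reflIn_plane_eq hreg ht hr₀ h hv htv
  omega

end CoxeterSystem

namespace CoxeterSystem

section Signs

variable {B W : Type*} [Group W] {M : CoxeterMatrix B} {cs : CoxeterSystem M W}

lemma IsReflection.geomRep_root_ne_zero {t : W} (ht : cs.IsReflection t) (u : W) :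
    cs.geomRep u (cs.root t) ≠ 0 := by
  simpa using ht.root_ne_zero

lemma IsReflection.geomRep_root_nonneg_iff {t : W} (ht : cs.IsReflection t) (u : W) :
    0 ≤ cs.geomRep u (cs.root t) ↔ cs.length u < cs.length (u * t) := by
  rw [← ht.geomRep_root_eq_iff]
  refine ⟨fun h ↦ (ht.geomRep_root_or u).resolve_right fun h' ↦ ?_, fun h ↦ h ▸ cs.root_nonneg _⟩
  have h1 := cs.root_nonneg (u * t * u⁻¹)
  rw [← neg_eq_iff_eq_neg] at h'
  rw [← h', Left.nonneg_neg_iff] at h1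
  exact ht.geomRep_root_ne_zero u (le_antisymm h1 h)

lemma IsReflection.geomRep_root_nonpos_iff {t : W} (ht : cs.IsReflection t) (u : W) :
    cs.geomRep u (cs.root t) ≤ 0 ↔ cs.length (u * t) < cs.length u := by
  rw [← ht.geomRep_root_eq_neg_iff]
  refine ⟨fun h ↦ (ht.geomRep_root_or u).resolve_left fun h' ↦ ?_, fun h ↦ ?_⟩
  · exact ht.geomRep_root_ne_zero u (le_antisymm h (h' ▸ cs.root_nonneg _))
  · rw [h, Left.neg_nonpos_iff]
    exact cs.root_nonneg _

lemma IsReflection.geomRep_inv_root_nonneg_iff {t : W} (ht : cs.IsReflection t) (v : W) :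
    0 ≤ cs.geomRep v⁻¹ (cs.root t) ↔ cs.length v < cs.length (t * v) := by
  rw [ht.geomRep_root_nonneg_iff, ← cs.length_inv (t * v), mul_inv_rev, ht.inv, cs.length_inv]

lemma IsReflection.geomRep_inv_root_nonpos_iff {t : W} (ht : cs.IsReflection t) (v : W) :
    cs.geomRep v⁻¹ (cs.root t) ≤ 0 ↔ cs.length (t * v) < cs.length v := by
  rw [ht.geomRep_root_nonpos_iff, ← cs.length_inv (t * v), mul_inv_rev, ht.inv, cs.length_inv]

lemma _root_.BruhatLE.length_lt_of_not {r v w : W} (hr : cs.IsReflection r) (hv : BruhatLE cs v w)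
    (h : ¬ BruhatLE cs (r * v) w) : cs.length v < cs.length (r * v) := by
  by_contra! hc
  exact h (hv.mul_left hr (lt_of_le_of_ne hc (hr.length_mul_right_ne v)))

lemma IsReflection.exists_root_pos {r : W} (hr : cs.IsReflection r) {i : B}
    (h : r ≠ cs.simple i) : ∃ j, j ≠ i ∧ 0 < cs.root r j := by
  by_contra! hc
  apply h
  refine hr.eq_of_root_eq_smul (cs.isReflection_simple i) (c := cs.root r i) ?_
  ext j
  rw [root_simple]
  rcases eq_or_ne j i with rfl | hj
  · simp
  · simpa [hj.symm] using le_antisymm (hc j hj) (cs.root_nonneg r j)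

lemma exists_pos_smul_add_smul {u r r' : W} {i : B} (hu : cs.length u < cs.length (cs.simple i * u))
    (hr : cs.IsReflection r) (hr' : cs.IsReflection r') (hlr : cs.length (u * r) < cs.length u)
    (hlr' : cs.length u < cs.length (u * r')) (hr't : r' ≠ u⁻¹ * cs.simple i * u)
    (hp : cs.root r ∈ cs.plane (u⁻¹ * cs.simple i * u) r') :
    ∃ x y : ℝ, 0 < x ∧ 0 < y ∧
      cs.root (u⁻¹ * cs.simple i * u) = x • cs.root r + y • cs.root r' := by
  obtain ⟨x, y, hxy⟩ := mem_plane.1 hp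
  set t := u⁻¹ * cs.simple i * u with ht_def
  have ht : cs.IsReflection t := by simpa using (cs.isReflection_simple i).conj u⁻¹
  have hut : u * t * u⁻¹ = cs.simple i := by simp [ht_def, mul_assoc]
  have hut' : u * t = cs.simple i * u := by simp [ht_def, mul_assoc]
  have hrt : r ≠ t := by
    rintro rfl
    rw [hut'] at hlr
    omega
  have hy0 : y ≠ 0 := by
    rintro rfl
    exact hrt (hr.eq_of_root_eq_smul ht (c := x) (by rw [← hxy]; simp))
  have h1 : cs.geomRep u (cs.root t) = Finsupp.single i 1 := by
    rw [(ht.geomRep_root_eq_iff u).2 (by rwa [hut']), hut, root_simple]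
  have h2 := (hr'.geomRep_root_eq_iff u).2 hlr'
  obtain ⟨j, hj, hjpos⟩ := (hr'.conj u).exists_root_pos (i := i)
    (fun h ↦ hr't (by rw [ht_def, ← h]; group))
  have h3 : cs.geomRep u (cs.root r) j ≤ 0 := (hr.geomRep_root_nonpos_iff u).2 hlr j
  rw [← hxy, map_add, map_smul, map_smul, h1, h2] at h3
  simp [hj.symm] at h3
  have hy : y < 0 := by
    refine lt_of_le_of_ne ?_ hy0
    by_contra! hc
    have := mul_pos hc hjpos
    linarith
  have hx : 0 < x := by
    by_contra! hc
    have h4 : cs.root r ≤ 0 := by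
      rw [← hxy]
      exact add_nonpos (smul_nonpos_of_nonpos_of_nonneg hc (cs.root_nonneg t))
        (smul_nonpos_of_nonpos_of_nonneg hy.le (cs.root_nonneg r'))
    exact hr.root_ne_zero (le_antisymm h4 (cs.root_nonneg r))
  refine ⟨x⁻¹, x⁻¹ * (-y), by positivity, mul_pos (by positivity) (by linarith), ?_⟩
  rw [← hxy, smul_add, smul_smul, inv_mul_cancel₀ hx.ne']
  module

end Signs

open scoped Classical

variable {B W : Type*} [Group W] [Fintype W] {M : CoxeterMatrix B} {cs : CoxeterSystem M W}

/-- Missing neighbours on the two sides of an edge cannot be separated by the root of the edge. -/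
lemma not_separated {w a t r r' : W} (ht : cs.IsReflection t) (hr : cs.IsReflection r)
    (hr' : cs.IsReflection r') (ha : BruhatLE cs a w) (hta : BruhatLE cs (t * a) w)
    (hl : cs.length a < cs.length (t * a)) (hra : ¬ BruhatLE cs (r * a) w)
    (hr'b : 0 ≤ cs.geomRep (t * a)⁻¹ (cs.root r')) {x y : ℝ} (hx : 0 < x) (hy : 0 < y)
    (hxy : cs.root t = x • cs.root r + y • cs.root r') : False := by
  induction hn : (Finset.univ.filter fun ρ ↦ ∃ p q : ℝ, 0 < p ∧ 0 < q ∧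
      cs.root ρ = p • cs.root r + q • cs.root r').card using Nat.strong_induction_on
      generalizing a t r x y with
  | _ n ih =>
  subst hn
  set b := t * a with hb
  have hta' : t * b = a := by rw [hb, ← mul_assoc, ht.mul_self, one_mul]
  have htb : cs.geomRep b⁻¹ (cs.root t) ≤ 0 :=
    (ht.geomRep_inv_root_nonpos_iff b).2 (by rwa [hta'])
  have hra' : 0 ≤ cs.geomRep a⁻¹ (cs.root r) :=
    (hr.geomRep_inv_root_nonneg_iff a).2 (ha.length_lt_of_not hr hra)
  have hba : cs.geomRep b⁻¹ (cs.geomRep t (cs.root r)) = cs.geomRep a⁻¹ (cs.root r) := by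
    rw [← LinearEquiv.mul_apply, ← map_mul, hb, mul_inv_rev, ht.inv, mul_assoc, ht.mul_self,
      mul_one]
  have hr₁ := hr.conj t
  have hk := ht.geomRep_apply (cs.root r)
  set k := 2 * M.titsForm (cs.root t) (cs.root r) with hk_def
  set r₁ := t * r * t⁻¹ with hr₁_def
  rcases hr.geomRep_root_or t with h | h
  · rw [h] at hk hba
    rw [← hba] at hra'
    have e : (1 - x * k) • cs.root t = x • cs.root r₁ + y • cs.root r' := by
      rw [hk, sub_smul, one_smul]
      nth_rewrite 1 [hxy]
      module
    have hpos : 0 ≤ x • cs.root r₁ + y • cs.root r' :=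
      add_nonneg (smul_nonneg hx.le (cs.root_nonneg _)) (smul_nonneg hy.le (cs.root_nonneg _))
    have h1 : 0 < 1 - x * k := by
      by_contra! hc
      have h2 : (1 - x * k) • cs.root t ≤ 0 :=
        smul_nonpos_of_nonpos_of_nonneg hc (cs.root_nonneg t)
      rw [e] at h2
      have h3 : x • cs.root r₁ ≤ 0 :=
        (le_add_of_nonneg_right (smul_nonneg hy.le (cs.root_nonneg _))).trans h2
      have h4 := le_antisymm h3 (smul_nonneg hx.le (cs.root_nonneg _))
      exact hr₁.root_ne_zero ((smul_eq_zero.1 h4).resolve_left hx.ne')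
    have e2 := congrArg (cs.geomRep b⁻¹) e
    rw [map_smul, map_add, map_smul, map_smul] at e2
    have h5 : 0 ≤ (1 - x * k) • cs.geomRep b⁻¹ (cs.root t) := by
      rw [e2]
      exact add_nonneg (smul_nonneg hx.le hra') (smul_nonneg hy.le hr'b)
    have h6 := le_antisymm (smul_nonpos_of_nonneg_of_nonpos h1.le htb) h5
    exact ht.geomRep_root_ne_zero _ ((smul_eq_zero.1 h6).resolve_left h1.ne')
  · rw [h] at hk hba
    have hr₁k : cs.root r₁ = k • cs.root t - cs.root r := by
      rw [← neg_neg (cs.root r₁), hk]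
      module
    have hneg : cs.geomRep b⁻¹ (cs.root r₁) ≤ 0 := by
      rw [← hba, map_neg, Left.nonneg_neg_iff] at hra'
      exact hra'
    have e : cs.root r₁ = (k - x⁻¹) • cs.root t + (x⁻¹ * y) • cs.root r' := by
      have : cs.root r = x⁻¹ • cs.root t - (x⁻¹ * y) • cs.root r' := by
        rw [hxy, smul_add, smul_smul, inv_mul_cancel₀ hx.ne']
        module
      rw [hr₁k]
      nth_rewrite 1 [this]
      module
    have hkx : 0 < k - x⁻¹ := by
      by_contra! hc
      have e2 := congrArg (cs.geomRep b⁻¹) e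
      rw [map_add, map_smul, map_smul] at e2
      have h5 : 0 ≤ cs.geomRep b⁻¹ (cs.root r₁) := by
        rw [e2]
        exact add_nonneg (smul_nonneg_of_nonpos_of_nonpos hc htb)
          (smul_nonneg (by positivity) hr'b)
      exact hr₁.geomRep_root_ne_zero _ (le_antisymm hneg h5)
    have hlr₁ := (hr₁.geomRep_inv_root_nonpos_iff b).1 hneg
    have hr₁b : r₁ * (r₁ * b) = b := by rw [← mul_assoc, hr₁.mul_self, one_mul]
    refine ih _ (Finset.card_lt_card ?_) (a := r₁ * b) (t := r₁) (r := t) hr₁ ht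
      (hta.mul_left hr₁ hlr₁) (by rwa [hr₁b]) (by rwa [hr₁b]) ?_ (by rwa [hr₁b]) hkx
      (y := x⁻¹ * y) (by positivity) e rfl
    · rw [Finset.ssubset_iff_of_subset]
      · refine ⟨t, by simpa using ⟨x, hx, y, hy, hxy⟩, ?_⟩
        simp only [Finset.mem_filter, Finset.mem_univ, true_and]
        rintro ⟨p, q, hp, hq, hpq⟩
        have h7 : cs.root r' = (q⁻¹ * (1 - p)) • cs.root t := by
          have : (1 - p) • cs.root t = q • cs.root r' := by
            rw [sub_smul, one_smul]
            nth_rewrite 1 [hpq]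
            module
          rw [mul_smul, this, smul_smul, inv_mul_cancel₀ hq.ne', one_smul]
        have h8 := hr'.eq_of_root_eq_smul ht h7
        rw [h8] at hr'b
        exact ht.geomRep_root_ne_zero _ (le_antisymm htb hr'b)
      · intro ρ
        simp only [Finset.mem_filter, Finset.mem_univ, true_and]
        rintro ⟨p, q, hp, hq, hpq⟩
        refine ⟨p * x, p * y + q, by positivity, by positivity, ?_⟩
        rw [hpq, hxy]
        module
    · have : t * (r₁ * b) = r * a := by
        rw [hr₁_def, hb, ht.inv]
        simp only [← mul_assoc, ht.mul_self, one_mul]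
        rw [mul_assoc r, ht.mul_self, mul_one]
      rwa [this]

/-- The right inversions of `u`. -/
noncomputable def rightInv (cs : CoxeterSystem M W) (u : W) : Finset W :=
  {t | cs.IsReflection t ∧ cs.length (u * t) < cs.length u}

lemma mem_rightInv {u t : W} :
    t ∈ cs.rightInv u ↔ cs.IsReflection t ∧ cs.length (u * t) < cs.length u := by simp [rightInv]

lemma card_reflOut_inter_rightInv_of_lt {w : W}
    (hreg : ∀ v, BruhatLE cs v w → (cs.reflIn {v | BruhatLE cs v w} v).card = cs.length w)
    {u : W} {i : B} (hu : cs.length u < cs.length (cs.simple i * u)) {a : W}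
    (ha : BruhatLE cs a w) (hta : BruhatLE cs (u⁻¹ * cs.simple i * u * a) w)
    (hl : cs.length a < cs.length (u⁻¹ * cs.simple i * u * a)) :
    (cs.reflOut {v | BruhatLE cs v w} a ∩ cs.rightInv u).card =
      (cs.reflOut {v | BruhatLE cs v w} (u⁻¹ * cs.simple i * u * a) ∩ cs.rightInv u).card := by
  set t := u⁻¹ * cs.simple i * u with ht_def
  have ht : cs.IsReflection t := by simpa using (cs.isReflection_simple i).conj u⁻¹
  have hut' : u * t = cs.simple i * u := by simp [ht_def, mul_assoc]
  have htN : t ∉ cs.rightInv u := by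
    rw [mem_rightInv, hut']
    omega
  set V := {v | BruhatLE cs v w} with hV
  let T : Finset (Submodule ℝ (B →₀ ℝ)) :=
    (Finset.univ.filter fun r ↦ cs.IsReflection r).image (cs.plane t)
  have hmaps : ∀ x, Set.MapsTo (cs.plane t) (cs.reflOut V x ∩ cs.rightInv u : Finset W) T := by
    intro x r hr
    simp only [Finset.coe_inter, Set.mem_inter_iff, Finset.mem_coe, mem_rightInv] at hr
    exact Finset.mem_image_of_mem _ (by simpa using hr.2.1)
  rw [Finset.card_eq_sum_card_fiberwise (hmaps _), Finset.card_eq_sum_card_fiberwise (hmaps _)]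
  refine Finset.sum_congr rfl fun P hP ↦ ?_
  obtain ⟨r₀, hr₀, rfl⟩ := Finset.mem_image.1 hP
  simp only [Finset.mem_filter, Finset.mem_univ, true_and] at hr₀
  by_cases hr₀t : r₀ = t
  · have : ∀ x, (cs.reflOut V x ∩ cs.rightInv u).filter (cs.plane t · = cs.plane t r₀) = ∅ := by
      intro x
      rw [Finset.filter_eq_empty_iff, hr₀t]
      intro r hr he
      rw [Finset.mem_inter] at hr
      have hne : r ≠ t := by
        rintro rfl
        exact htN hr.2
      exact ((ht.plane_eq_iff ht hne (mem_rightInv.1 hr.2).1).1 he.symm).1 rfl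
    rw [this, this]
  have hcard := card_reflOut_plane_eq hreg ht hr₀ hr₀t ha hta
  have hmem : ∀ r, cs.IsReflection r → cs.plane t r = cs.plane t r₀ → r ≠ t := fun r hr he ↦
    ((ht.plane_eq_iff hr hr₀t hr₀).1 he).1
  have hsep : ∀ r r', cs.IsReflection r → cs.IsReflection r' → cs.plane t r = cs.plane t r₀ →
      cs.plane t r' = cs.plane t r₀ → r ∈ cs.rightInv u → r' ∉ cs.rightInv u →
      ∃ x y : ℝ, 0 < x ∧ 0 < y ∧ cs.root t = x • cs.root r + y • cs.root r' := by
    intro r r' hr hr' hrP hr'P hrN hr'N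
    refine exists_pos_smul_add_smul hu hr hr' (mem_rightInv.1 hrN).2 ?_ (hmem r' hr' hr'P) ?_
    · have h1 := hr'.length_mul_left_ne u
      have h2 : ¬ cs.length (u * r') < cs.length u := fun h ↦ hr'N (mem_rightInv.2 ⟨hr', h⟩)
      omega
    · rw [← ht_def, hr'P, ← hrP]
      exact cs.root_mem_plane_right t r
  rw [← Finset.filter_inter, ← Finset.filter_inter]
  set A := (cs.reflOut V a).filter fun r ↦ cs.plane t r = cs.plane t r₀ with hA
  set A' := (cs.reflOut V (t * a)).filter fun r ↦ cs.plane t r = cs.plane t r₀ with hA'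
  have hsame : ∀ r ∈ A, ∀ r' ∈ A', (r ∈ cs.rightInv u ↔ r' ∈ cs.rightInv u) := by
    intro r hr r' hr'
    rw [hA, Finset.mem_filter, mem_reflOut] at hr
    rw [hA', Finset.mem_filter, mem_reflOut] at hr'
    have h1 : 0 ≤ cs.geomRep (t * a)⁻¹ (cs.root r') :=
      (hr'.1.1.geomRep_inv_root_nonneg_iff _).2 (hta.length_lt_of_not hr'.1.1 hr'.1.2)
    by_contra hc
    by_cases h2 : r ∈ cs.rightInv u
    · have h3 : r' ∉ cs.rightInv u := by tauto
      obtain ⟨x, y, hx, hy, hxy⟩ := hsep r r' hr.1.1 hr'.1.1 hr.2 hr'.2 h2 h3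
      exact not_separated ht hr.1.1 hr'.1.1 ha hta hl hr.1.2 h1 hx hy hxy
    · have h3 : r' ∈ cs.rightInv u := by tauto
      obtain ⟨x, y, hx, hy, hxy⟩ := hsep r' r hr'.1.1 hr.1.1 hr'.2 hr.2 h3 h2
      rw [add_comm] at hxy
      exact not_separated ht hr.1.1 hr'.1.1 ha hta hl hr.1.2 h1 hy hx hxy
  rcases A.eq_empty_or_nonempty with h0 | ⟨r, hr⟩
  · rw [h0, Finset.card_empty, eq_comm, Finset.card_eq_zero] at hcard
    rw [h0, hcard]
  · have hA'0 : A'.Nonempty := by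
      rw [← Finset.card_pos, ← hcard, Finset.card_pos]
      exact ⟨r, hr⟩
    obtain ⟨r', hr'⟩ := hA'0
    by_cases h2 : r ∈ cs.rightInv u
    · rw [Finset.inter_eq_left.2 fun x hx ↦ (hsame x hx r' hr').2 ((hsame r hr r' hr').1 h2),
        Finset.inter_eq_left.2 fun x hx ↦ (hsame r hr x hx).1 h2]
      exact hcard
    · have h3 : A ∩ cs.rightInv u = ∅ := by
        rw [← Finset.disjoint_iff_inter_eq_empty, Finset.disjoint_left]
        intro x hx hxN
        exact h2 ((hsame r hr r' hr').2 ((hsame x hx r' hr').1 hxN))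
      have h4 : A' ∩ cs.rightInv u = ∅ := by
        rw [← Finset.disjoint_iff_inter_eq_empty, Finset.disjoint_left]
        intro x hx hxN
        exact h2 ((hsame r hr x hx).2 hxN)
      rw [h3, h4]

/-- In a regular lower interval, the numbers of edges at two adjacent vertices which are not
inversions of `u` agree, whenever the root of the edge becomes simple under `u`. -/
theorem card_reflIn_sdiff_rightInv {w : W}
    (hreg : ∀ v, BruhatLE cs v w → (cs.reflIn {v | BruhatLE cs v w} v).card = cs.length w)
    {u : W} {i : B} (hu : cs.length u < cs.length (cs.simple i * u)) {a : W}
    (ha : BruhatLE cs a w) (hta : BruhatLE cs (u⁻¹ * cs.simple i * u * a) w) :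
    (cs.reflIn {v | BruhatLE cs v w} a \ cs.rightInv u).card =
      (cs.reflIn {v | BruhatLE cs v w} (u⁻¹ * cs.simple i * u * a) \ cs.rightInv u).card := by
  wlog hl : cs.length a < cs.length (u⁻¹ * cs.simple i * u * a) generalizing a
  · have ht : cs.IsReflection (u⁻¹ * cs.simple i * u) := by
      simpa using (cs.isReflection_simple i).conj u⁻¹
    have h1 := ht.length_mul_right_ne a
    have h2 : u⁻¹ * cs.simple i * u * (u⁻¹ * cs.simple i * u * a) = a := by
      rw [← mul_assoc, ht.mul_self, one_mul]
    have := this hta (by rwa [h2]) (by rw [h2]; omega)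
    rw [h2] at this
    exact this.symm
  have key : ∀ x, (cs.reflIn {v | BruhatLE cs v w} x ∩ cs.rightInv u).card +
      (cs.reflOut {v | BruhatLE cs v w} x ∩ cs.rightInv u).card = (cs.rightInv u).card := by
    intro x
    rw [← Finset.card_union_of_disjoint]
    · congr 1
      ext r
      simp only [Finset.mem_union, Finset.mem_inter, mem_reflIn, mem_reflOut, mem_rightInv]
      tauto
    · rw [Finset.disjoint_left]
      intro r h1 h2
      simp only [Finset.mem_inter, mem_reflIn, mem_reflOut] at h1 h2
      tauto
  have h1 := card_reflOut_inter_rightInv_of_lt hreg hu ha hta hl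
  have h2 := key a
  have h3 := key (u⁻¹ * cs.simple i * u * a)
  have h4 := Finset.card_sdiff_add_card_inter (cs.reflIn {v | BruhatLE cs v w} a) (cs.rightInv u)
  have h5 := Finset.card_sdiff_add_card_inter
    (cs.reflIn {v | BruhatLE cs v w} (u⁻¹ * cs.simple i * u * a)) (cs.rightInv u)
  rw [hreg _ ha] at h4
  rw [hreg _ hta] at h5
  omega

end CoxeterSystem

namespace CoxeterSystem

section

variable {B W : Type*} [Group W] {M : CoxeterMatrix B} {cs : CoxeterSystem M W}

lemma length_mul_lt_simple_mul_iff {u v : W} {i : B}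
    (hu : cs.length u < cs.length (cs.simple i * u)) :
    cs.length (u * v) < cs.length (cs.simple i * (u * v)) ↔
      cs.length v < cs.length (u⁻¹ * cs.simple i * u * v) := by
  have ht : cs.IsReflection (u⁻¹ * cs.simple i * u) := by
    simpa using (cs.isReflection_simple i).conj u⁻¹
  have h1 : cs.geomRep u (cs.root (u⁻¹ * cs.simple i * u)) = cs.root (cs.simple i) := by
    rw [(ht.geomRep_root_eq_iff u).2 (by simpa [← mul_assoc] using hu)]
    congr 1
    group
  rw [← (cs.isReflection_simple i).geomRep_inv_root_nonneg_iff, ← ht.geomRep_inv_root_nonneg_iff,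
    mul_inv_rev, ← h1, ← LinearEquiv.mul_apply, ← map_mul, inv_mul_cancel_right]

end

open scoped Classical

variable {B W : Type*} [Group W] [Fintype W] {M : CoxeterMatrix B} {cs : CoxeterSystem M W}

lemma rightInv_simple_mul {u : W} {i : B} (hu : cs.length u < cs.length (cs.simple i * u)) :
    cs.rightInv (cs.simple i * u) = insert (u⁻¹ * cs.simple i * u) (cs.rightInv u) := by
  have ht : cs.IsReflection (u⁻¹ * cs.simple i * u) := by
    simpa using (cs.isReflection_simple i).conj u⁻¹
  ext r
  rw [Finset.mem_insert, mem_rightInv, mem_rightInv]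
  by_cases hr : r = u⁻¹ * cs.simple i * u
  · subst hr
    simpa [ht, ← mul_assoc] using hu
  · simp only [hr, false_or, and_congr_right_iff]
    intro h
    refine h.length_simple_mul_mul_lt_iff fun h' ↦ hr ?_
    rw [mul_assoc, ← h', inv_mul_cancel_left]

/-- In a regular lower interval, the shifted sum of `R`-polynomials does not depend on the
element `y` it is shifted by. -/
theorem sum_pow_card_reflIn_mul_R {w : W}
    (hreg : ∀ v, BruhatLE cs v w → (cs.reflIn {v | BruhatLE cs v w} v).card = cs.length w)
    {R : W → W → ℤ[X]} (hR : IsRFamily cs R) (y : W) :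
    ∑ v with BruhatLE cs v w, X ^ (cs.reflIn {v | BruhatLE cs v w} v \ cs.rightInv y⁻¹).card *
      R (v⁻¹ * y) y = X ^ cs.length w := by
  refine cs.length_induction_right (P := fun y ↦ ∑ v with BruhatLE cs v w,
    X ^ (cs.reflIn {v | BruhatLE cs v w} v \ cs.rightInv y⁻¹).card * R (v⁻¹ * y) y =
      X ^ cs.length w) y ?_ fun y i hy ih ↦ ?_
  · rw [Finset.sum_eq_single_of_mem 1 (by simpa using cs.one_bruhatLE w)]
    · have : cs.rightInv 1 = ∅ := by
        ext
        simp [mem_rightInv]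
      rw [inv_one, mul_one, hR.2.1, this, Finset.sdiff_empty, hreg _ (cs.one_bruhatLE w), mul_one]
    · intro v _ hv
      rw [hR.1 _ _ fun h ↦ hv ?_, mul_zero]
      simpa using eq_one_of_bruhatLE_one h
  rw [← ih, ← sub_eq_zero, ← Finset.sum_sub_distrib]
  obtain ⟨u, rfl⟩ : ∃ u, u⁻¹ = y := ⟨y⁻¹, inv_inv y⟩
  have hu : cs.length u < cs.length (cs.simple i * u) := by
    rwa [← cs.length_inv u, ← cs.length_inv (_ * u), mul_inv_rev, cs.inv_simple]
  set t := u⁻¹ * cs.simple i * u with ht_def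
  have ht : cs.IsReflection t := by simpa using (cs.isReflection_simple i).conj u⁻¹
  have hut : ∀ v, (t * v)⁻¹ * u⁻¹ = v⁻¹ * u⁻¹ * cs.simple i := by
    intro v
    simp [ht_def, mul_assoc]
  have htN : t ∉ cs.rightInv u := by
    simp [mem_rightInv, ht_def, ← mul_assoc, hu.le]
  have hN : cs.rightInv (u⁻¹ * cs.simple i)⁻¹ = insert t (cs.rightInv u) := by
    rw [mul_inv_rev, cs.inv_simple, inv_inv, rightInv_simple_mul hu]
  have hlen : ∀ v, cs.length (v⁻¹ * u⁻¹) < cs.length (v⁻¹ * u⁻¹ * cs.simple i) ↔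
      cs.length v < cs.length (t * v) := by
    intro v
    rw [← length_mul_lt_simple_mul_iff hu, ← mul_inv_rev, cs.length_inv,
      ← cs.length_inv (_ * (u * v)), mul_inv_rev (cs.simple i), cs.inv_simple]
  have htt : ∀ v, t * (t * v) = v := fun v ↦ by rw [← mul_assoc, ht.mul_self, one_mul]
  have hback : u⁻¹ * cs.simple i * cs.simple i = u⁻¹ := by simp
  have hys : cs.length (u⁻¹ * cs.simple i * cs.simple i) < cs.length (u⁻¹ * cs.simple i) := by
    rwa [hback]
  have hup : ∀ v, cs.length v < cs.length (t * v) →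
      R (v⁻¹ * (u⁻¹ * cs.simple i)) (u⁻¹ * cs.simple i) = R (v⁻¹ * u⁻¹) u⁻¹ := by
    intro v hv
    rw [(hR.2.2 _ _ i hys).1, hback]
    · simp [mul_assoc]
    · simpa [mul_assoc] using (hlen v).2 hv
  have hdown : ∀ v, cs.length v < cs.length (t * v) →
      R ((t * v)⁻¹ * (u⁻¹ * cs.simple i)) (u⁻¹ * cs.simple i) =
        (X - 1) * R (v⁻¹ * u⁻¹) u⁻¹ + X * R ((t * v)⁻¹ * u⁻¹) u⁻¹ := by
    intro v hv
    have h1 : (t * v)⁻¹ * (u⁻¹ * cs.simple i) = v⁻¹ * u⁻¹ := by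
      rw [← mul_assoc, hut]
      simp
    rw [h1, (hR.2.2 _ _ i hys).2 ((hlen v).2 hv), hback, hut]
  set V := {v | BruhatLE cs v w} with hV
  rw [hN, inv_inv]
  have hpair : ∀ v, v ∈ V → t * v ∈ V → cs.length v < cs.length (t * v) →
      X ^ (cs.reflIn V v \ insert t (cs.rightInv u)).card *
          R (v⁻¹ * (u⁻¹ * cs.simple i)) (u⁻¹ * cs.simple i) -
        X ^ (cs.reflIn V v \ cs.rightInv u).card * R (v⁻¹ * u⁻¹) u⁻¹ +
      (X ^ (cs.reflIn V (t * v) \ insert t (cs.rightInv u)).card *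
          R ((t * v)⁻¹ * (u⁻¹ * cs.simple i)) (u⁻¹ * cs.simple i) -
        X ^ (cs.reflIn V (t * v) \ cs.rightInv u).card * R ((t * v)⁻¹ * u⁻¹) u⁻¹) = 0 := by
    intro v hv htv hl
    rw [hup v hl, hdown v hl]
    have h1 := card_reflIn_sdiff_rightInv hreg hu hv htv
    have h2 : t ∈ cs.reflIn V v \ cs.rightInv u := by simp [mem_reflIn, ht, htv, htN]
    have h3 : t ∈ cs.reflIn V (t * v) \ cs.rightInv u := by simp [mem_reflIn, ht, htt, hv, htN]
    have h4 := Finset.card_erase_add_one h2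
    have h5 := Finset.card_erase_add_one h3
    rw [Finset.sdiff_insert, Finset.sdiff_insert, ← h4, ← h5]
    rw [← ht_def, ← h4, ← h5] at h1
    rw [← Nat.succ_injective h1]
    ring
  refine Finset.sum_involution (fun v _ ↦ if t * v ∈ V then t * v else v) ?_ ?_ ?_ ?_
  · intro v hv
    replace hv : v ∈ V := (Finset.mem_filter.1 hv).2
    split_ifs with htv
    · rcases lt_or_gt_of_ne (ht.length_mul_right_ne v) with hl | hl
      · have := hpair (t * v) htv (by rwa [htt]) (by rwa [htt])
        rw [htt, add_comm] at this
        exact this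
      · exact hpair v hv htv hl
    · have h1 : t ∉ cs.reflIn V v := fun h ↦ htv (mem_reflIn.1 h).2
      rw [hup v (BruhatLE.length_lt_of_not ht hv htv), Finset.sdiff_insert,
        Finset.erase_eq_of_notMem fun h ↦ h1 (Finset.mem_sdiff.1 h).1]
      ring
  · intro v hv hne
    replace hv : v ∈ V := (Finset.mem_filter.1 hv).2
    split_ifs with htv
    · exact fun h ↦ ht.length_mul_right_ne v (by rw [h])
    · refine absurd ?_ hne
      have h1 : t ∉ cs.reflIn V v := fun h ↦ htv (mem_reflIn.1 h).2
      rw [hup v (BruhatLE.length_lt_of_not ht hv htv), Finset.sdiff_insert,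
        Finset.erase_eq_of_notMem fun h ↦ h1 (Finset.mem_sdiff.1 h).1]
      ring
  · intro v hv
    split_ifs with htv
    · exact Finset.mem_filter.2 ⟨Finset.mem_univ _, htv⟩
    · exact hv
  · intro v hv
    replace hv : v ∈ V := (Finset.mem_filter.1 hv).2
    split_ifs with h1 h2
    · exact htt v
    · exact absurd (by rwa [htt]) h2
    · rfl

end CoxeterSystem

namespace CoxeterSystem

variable {B W : Type*} [Group W] {M : CoxeterMatrix B} (cs : CoxeterSystem M W)

/-- The operator on functions on `W` describing the recursion of `R`-polynomials under right
multiplication by a simple reflection. -/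
noncomputable def rightOp (i : B) (f : W → ℤ[X]) (x : W) : ℤ[X] :=
  if cs.length (x * cs.simple i) < cs.length x then f (x * cs.simple i)
  else (X - 1) * f x + X * f (x * cs.simple i)

/-- The operator on functions on `W` describing the recursion of `R`-polynomials under left
multiplication by a simple reflection. -/
noncomputable def leftOp (i : B) (f : W → ℤ[X]) (x : W) : ℤ[X] :=
  if cs.length (cs.simple i * x) < cs.length x then f (cs.simple i * x)
  else (X - 1) * f x + X * f (cs.simple i * x)

lemma leftOp_eq_rightOp {i j : B} {x : W} (h : cs.simple i * x = x * cs.simple j) (f : W → ℤ[X]) :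
    cs.leftOp i f x = cs.rightOp j f x := by
  rw [leftOp, rightOp, h]

lemma leftOp_rightOp_comm (i j : B) (f : W → ℤ[X]) :
    cs.leftOp i (cs.rightOp j f) = cs.rightOp j (cs.leftOp i f) := by
  ext1 x
  by_cases h : cs.simple i * x = x * cs.simple j
  · have h' : cs.simple i * (x * cs.simple j) = x * cs.simple j * cs.simple j := by
      rw [← h, ← mul_assoc, cs.simple_mul_simple_self, one_mul, h, mul_assoc,
        cs.simple_mul_simple_self, mul_one]
    rw [leftOp_eq_rightOp cs h, rightOp.eq_def cs j (cs.rightOp j f) x,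
      rightOp.eq_def cs j (cs.leftOp i f) x, leftOp_eq_rightOp cs h, leftOp_eq_rightOp cs h']
  · have h1 := (cs.isReflection_simple j).length_simple_mul_mul_lt_iff (u := x) (i := i) (Ne.symm h)
    have h2 := (cs.isReflection_simple i).length_mul_mul_simple_lt_iff (u := x) (i := j) h
    rw [mul_assoc] at h1
    simp only [leftOp, rightOp, h1, h2, mul_assoc]
    split_ifs <;> ring

variable {cs} {R : W → W → ℤ[X]}

lemma _root_.IsRFamily.eq_rightOp (hR : IsRFamily cs R) {y : W} {i : B}
    (h : cs.length (y * cs.simple i) < cs.length y) :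
    (R · y) = cs.rightOp i (R · (y * cs.simple i)) := by
  ext1 x
  rw [rightOp]
  split_ifs with hx
  · exact (hR.2.2 x y i h).1 hx
  · refine (hR.2.2 x y i h).2 ?_
    have := (cs.isReflection_simple i).length_mul_left_ne x
    omega

lemma _root_.IsRFamily.apply_one_of_ne (hR : IsRFamily cs R) {x : W} (h : x ≠ 1) : R x 1 = 0 :=
  hR.1 _ _ fun h' ↦ h (eq_one_of_bruhatLE_one h')

lemma _root_.IsRFamily.eq_leftOp (hR : IsRFamily cs R) {y : W} {i : B}
    (h : cs.length (cs.simple i * y) < cs.length y) :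
    (R · y) = cs.leftOp i (R · (cs.simple i * y)) := by
  induction hn : cs.length y using Nat.strong_induction_on generalizing y with
  | _ n ih =>
  subst hn
  rcases eq_or_ne (cs.simple i * y) 1 with h1 | h1
  · obtain rfl : y = cs.simple i := by
      rw [← mul_left_cancel_iff (a := cs.simple i), h1, cs.simple_mul_simple_self]
    rw [hR.eq_rightOp h]
    ext1 x
    by_cases hx : cs.simple i * x = x * cs.simple i
    · exact (leftOp_eq_rightOp cs hx _).symm
    · have hx1 : x ≠ 1 := by
        rintro rfl
        simp at hx
      have hx2 : cs.simple i * x ≠ 1 := fun h' ↦ by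
        have : x = cs.simple i := by
          rw [← mul_left_cancel_iff (a := cs.simple i), h', cs.simple_mul_simple_self]
        simp [this] at hx
      have hx3 : x * cs.simple i ≠ 1 := fun h' ↦ by
        have : x = cs.simple i := by
          rw [← mul_right_cancel_iff (a := cs.simple i), h', cs.simple_mul_simple_self]
        simp [this] at hx
      simp [rightOp, leftOp, hR.apply_one_of_ne, hx1, hx2, hx3]
  · obtain ⟨j, hj⟩ := cs.exists_rightDescent_of_ne_one h1
    rw [IsRightDescent] at hj
    have h2 := cs.length_simple_mul (cs.simple i * y * cs.simple j) i
    have h3 : cs.simple i * (cs.simple i * y * cs.simple j) = y * cs.simple j := by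
      simp [← mul_assoc]
    rw [h3] at h2
    have h4 := cs.length_mul_simple (cs.simple i * y) j
    have h5 := cs.length_mul_simple y j
    have h6 := cs.length_simple_mul y i
    have hyj : cs.length (y * cs.simple j) < cs.length y := by omega
    rw [hR.eq_rightOp hyj, ih _ hyj (by rw [← mul_assoc]; omega) rfl, hR.eq_rightOp hj,
      leftOp_rightOp_comm, mul_assoc]

lemma _root_.IsRFamily.eq_simple_mul (hR : IsRFamily cs R) {x y : W} {i : B}
    (hy : cs.length (cs.simple i * y) < cs.length y)
    (hx : cs.length (cs.simple i * x) < cs.length x) :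
    R x y = R (cs.simple i * x) (cs.simple i * y) := by
  have := congrFun (hR.eq_leftOp hy) x
  rwa [leftOp, if_pos hx] at this

lemma length_simple_mul_inv_mul_lt_iff {y₀ : W} (hy₀ : ∀ z, cs.length z ≤ cs.length y₀) (v : W)
    (i : B) : cs.length (cs.simple i * (v⁻¹ * y₀)) < cs.length (v⁻¹ * y₀) ↔
      cs.length v < cs.length (v * cs.simple i) := by
  have hi := cs.isReflection_simple i
  have hr := hi.conj v
  have h1 : cs.geomRep y₀⁻¹ (cs.root (v * cs.simple i * v⁻¹)) ≤ 0 :=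
    (hr.geomRep_inv_root_nonpos_iff y₀).2 ((hy₀ _).lt_of_ne (hr.length_mul_right_ne y₀))
  have h2 := hr.geomRep_root_ne_zero y₀⁻¹
  rw [← hi.geomRep_inv_root_nonpos_iff, ← hi.geomRep_root_eq_iff, mul_inv_rev, inv_inv, map_mul,
    LinearEquiv.mul_apply]
  rcases hi.geomRep_root_or v with h | h
  · simpa only [h, iff_true]
  · rw [h, map_neg, Left.neg_nonpos_iff]
    refine iff_of_false (fun h' ↦ h2 (le_antisymm h1 h')) fun h' ↦ ?_
    rw [neg_eq_iff_add_eq_zero, ← two_smul ℝ] at h'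
    exact hr.root_ne_zero ((smul_eq_zero.1 h').resolve_left two_ne_zero)

/-- Invariance of `R`-polynomials under the antiautomorphism `x ↦ x⁻¹ * y₀` of the Bruhat order,
where `y₀` is the longest element. -/
theorem _root_.IsRFamily.eq_inv_mul_longest (hR : IsRFamily cs R) {y₀ : W}
    (hy₀ : ∀ z, cs.length z ≤ cs.length y₀) (x v : W) : R x v = R (v⁻¹ * y₀) (x⁻¹ * y₀) := by
  refine cs.length_induction_right (P := fun v ↦ ∀ x, R x v = R (v⁻¹ * y₀) (x⁻¹ * y₀)) v ?_ ?_ x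
  · intro x
    rcases eq_or_ne x 1 with rfl | hx
    · rw [hR.2.1, hR.2.1]
    · rw [hR.apply_one_of_ne hx, hR.1 _ _ fun h ↦ hx ?_]
      simpa using BruhatLE.eq_of_length_le h (by simpa using hy₀ _)
  · intro v i hv ih x
    have hback : v * cs.simple i * cs.simple i = v := by simp
    have hy := (length_simple_mul_inv_mul_lt_iff hy₀ v i).2 hv
    have hss : ∀ z, cs.simple i * (cs.simple i * z) = z := fun z ↦ by simp [← mul_assoc]
    have hxi := length_simple_mul_inv_mul_lt_iff hy₀ x i
    have h1 := (cs.isReflection_simple i).length_mul_left_ne x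
    have h2 := (cs.isReflection_simple i).length_mul_right_ne (x⁻¹ * y₀)
    rw [congrFun (hR.eq_rightOp (y := v * cs.simple i) (i := i) (by rwa [hback])) x, rightOp, hback,
      ih, ih, mul_inv_rev, mul_inv_rev, cs.inv_simple, mul_assoc _ _ y₀, mul_assoc _ _ y₀]
    split_ifs with hx
    · rw [hR.eq_simple_mul (i := i) _ hy, hss]
      rw [hss]
      omega
    · have hx' : cs.length (cs.simple i * (x⁻¹ * y₀)) < cs.length (x⁻¹ * y₀) := by
        rw [hxi]
        omega
      rw [hR.eq_simple_mul hx' hy,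
        congrFun (hR.eq_leftOp hx') (cs.simple i * (v⁻¹ * y₀)), leftOp, if_neg, hss]
      rw [hss]
      omega

end CoxeterSystem

open scoped Classical in
/-- The sum of the `R`-polynomials over a regular lower Bruhat interval. -/
theorem CoxeterSystem.sum_R_one_eq_pow {B W : Type*} [Group W] [Fintype W] {M : CoxeterMatrix B}
    {cs : CoxeterSystem M W} {R : W → W → ℤ[X]} (hR : IsRFamily cs R) {w : W}
    (hreg : IsRegularOn cs {v : W | BruhatLE cs v w}) :
    ∑ v with BruhatLE cs v w, R 1 v = X ^ cs.length w := by
  obtain ⟨y₀, hy₀⟩ := Finite.exists_max cs.length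
  have hcard : ∀ v, BruhatLE cs v w →
      (cs.reflIn {v | BruhatLE cs v w} v).card = cs.length w := by
    intro v hv
    rw [← degIn_eq_card_reflIn, hreg v hv w Relation.ReflTransGen.refl, degIn_eq_card_reflIn,
      reflIn_bruhatLE_self, card_leftInv]
  rw [← sum_pow_card_reflIn_mul_R hcard hR y₀]
  refine Finset.sum_congr rfl fun v _ ↦ ?_
  have h : cs.reflIn {v | BruhatLE cs v w} v \ cs.rightInv y₀⁻¹ = ∅ := by
    rw [Finset.sdiff_eq_empty_iff_subset]
    intro t ht
    rw [mem_reflIn] at ht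
    refine mem_rightInv.2 ⟨ht.1, ?_⟩
    have := ht.1.length_mul_left_ne y₀⁻¹
    have := hy₀ (y₀⁻¹ * t)
    rw [cs.length_inv] at *
    omega
  rw [h, Finset.card_empty, pow_zero, one_mul, hR.eq_inv_mul_longest hy₀ 1 v, inv_one, one_mul]

theorem stmt9 {B W : Type*} [Group W] [Finite W] {M : CoxeterMatrix B}
    (cs : CoxeterSystem M W)
    (R : W → W → Polynomial ℤ) (hR : IsRFamily cs R)
    (w : W)
    (h : 2 * (∑ᶠ v ∈ {v : W | BruhatLE cs v w}, (Polynomial.derivative (R 1 v)).eval 2)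
        ≠ (cs.length w : ℤ) * (∑ᶠ v ∈ {v : W | BruhatLE cs v w}, (R 1 v).eval 2)) :
    ¬ IsRegularOn cs {v : W | BruhatLE cs v w} := by
  classical
  have := Fintype.ofFinite W
  intro hreg
  have hsum := CoxeterSystem.sum_R_one_eq_pow hR hreg
  have hfin : ∀ f : W → ℤ, ∑ᶠ v ∈ {v : W | BruhatLE cs v w}, f v =
      ∑ v with BruhatLE cs v w, f v := by
    intro f
    rw [← finsum_mem_coe_finset]
    simp
  apply h
  rw [hfin, hfin, ← eval_finsetSum, ← eval_finsetSum, ← derivative_sum]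
  have h1 : ∑ v with BruhatLE cs v w, R 1 v = X ^ cs.length w := by convert hsum
  rw [h1]
  rcases cs.length w with _ | n
  · simp
  · simp
    ring
end
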